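/- For all integers r ≥ 3, a, b ∈ {1,…,r−2} and L ≥ 0, the following polynomial identity holds: f_{a,b} Σ_{m ≡ Q_{a,b}} q^{(1/4) mᵀC m − (1/2) m_{r−a−1}} [ L ; m_1 ] ∏_{j=2}^{r−3} [ (1/2)(I m + e_{r−a−1} + e_{r−b−1})_j ; m_j ] = Σ_{j=−∞}^{∞} { q^{j(r(r−1)j + rb − (r−1)a)} [ L ; 2(r−1)j + b − a ]_2 − q^{((r−1)j+b)(rj+a)} [ L ; 2(r−1)j + b + a ]_2 }, where only finitely many terms of the sum over j are nonzero. -/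

import Mathlib

attribute [local instance] Classical.propDecidable

noncomputable section

variable {K : Type*} [Field K]

/-- `(q)_n` where `q = t^4` (the variable `t` stands for `q^{1/4}`). -/
def qp (t : K) (n : ℕ) : K :=
  ∏ k ∈ Finset.range n, (1 - t ^ (4 * (k + 1)))

/-- Gaussian polynomial `[N; m]` in the variable `q = t^4`. -/
def gauss (t : K) (N m : ℤ) : K :=
  if 0 ≤ m ∧ m ≤ N then qp t N.toNat / (qp t m.toNat * qp t (N - m).toNat) else 0

/-- Gaussian polynomial `[N2/2; m]` (zero if `N2` is odd). -/
def gaussHalf (t : K) (N2 m : ℤ) : K :=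
  if N2 % 2 = 0 then gauss t (N2 / 2) m else 0

/-- Incidence matrix of the Dynkin diagram `A_d` (indices `i : Fin d` stand for `i+1`). -/
def inc (d : ℕ) (i k : Fin d) : ℤ := if (i : ℕ) + 1 = (k : ℕ) ∨ (k : ℕ) + 1 = (i : ℕ) then 1 else 0

/-- Cartan matrix of `A_d`. -/
def cartan (d : ℕ) (i k : Fin d) : ℤ := (if i = k then 2 else 0) - inc d i k

/-- the `s`-th unit vector, with the convention `e_0 = e_{d+1} = 0`. -/
def uv (d : ℕ) (s : ℤ) (i : Fin d) : ℤ := if ((i : ℕ) : ℤ) + 1 = s then 1 else 0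

/-- `m_s`, with the conventions `m_0 = m_{d+1} = 0`. -/
def mAt (d : ℕ) (m : Fin d → ℕ) (s : ℤ) : ℤ := ∑ i, uv d s i * (m i : ℤ)

/-- `mᵀ C m` for the `A_d` Cartan matrix. -/
def quadC (d : ℕ) (m : Fin d → ℕ) : ℤ := ∑ i, ∑ k, (m i : ℤ) * cartan d i k * (m k : ℤ)

/-- the vector `Q_{a,b}`. -/
def Qab (r a b : ℕ) (i : Fin (r - 3)) : ℕ :=
  min (a - 1) (r - ((i : ℕ) + 1) - 2) + min (b - 1) (r - ((i : ℕ) + 1) - 2)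

/-- the parity restriction `m ≡ Q_{a,b} (mod 2)`. -/
def parity (r a b : ℕ) (m : Fin (r - 3) → ℕ) : Prop := ∀ i, m i % 2 = Qab r a b i % 2

/-- `(I m + L e_1 + e_{r-a-1} + e_{r-b-1})_i`. -/
def topE (r a b L : ℕ) (m : Fin (r - 3) → ℕ) (i : Fin (r - 3)) : ℤ :=
  (∑ k, inc (r - 3) i k * (m k : ℤ)) + (L : ℤ) * uv (r - 3) 1 i
    + uv (r - 3) ((r : ℤ) - a - 1) i + uv (r - 3) ((r : ℤ) - b - 1) i

/-- the summand `q^{(1/4) mᵀCm - (1/2) m_{r-a-1}} ∏_j [(1/2)(Im + Le_1 + e_{r-a-1} + e_{r-b-1})_j; m_j]`,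
in the variable `t = q^{1/4}`. -/
def fermTerm (r a b L : ℕ) (t : K) (m : Fin (r - 3) → ℕ) : K :=
  t ^ (quadC (r - 3) m - 2 * mAt (r - 3) m ((r : ℤ) - a - 1))
    * ∏ i, gaussHalf t (topE r a b L m i) (m i)

/-- the fermionic sum `Σ_{m ≡ Q_{a,b}} (⋯)`. -/
def fermSum (r a b L : ℕ) (t : K) : K :=
  ∑ᶠ m : Fin (r - 3) → ℕ, if parity r a b m then fermTerm r a b L t m else 0

/-- `(I m + e_{r-a-1} + e_{r-b-1})_i` (no `L e_1` term). -/
def topNoL (r a b : ℕ) (m : Fin (r - 3) → ℕ) (i : Fin (r - 3)) : ℤ :=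
  (∑ k, inc (r - 3) i k * (m k : ℤ))
    + uv (r - 3) ((r : ℤ) - a - 1) i + uv (r - 3) ((r : ℤ) - b - 1) i

/-- the `q`-deformed trinomial coefficient `[N; m]₂`, in the variable `q = t^4`. -/
def trinom (t : K) (N m : ℤ) : K :=
  ∑ᶠ k : ℕ, t ^ (4 * ((k : ℤ) * ((k : ℤ) + m))) * gauss t N (k : ℤ) * gauss t (N - k) ((k : ℤ) + m)


section helpers

lemma qp_succ (t : K) (n : ℕ) : qp t (n + 1) = qp t n * (1 - t ^ (4 * (n + 1))) := by
  simp [qp, Finset.prod_range_succ]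

lemma qp_ne {t : K} (hq : ∀ n : ℕ, 1 - t ^ (4 * (n + 1)) ≠ 0) (n : ℕ) : qp t n ≠ 0 :=
  Finset.prod_ne_zero_iff.2 fun k _ => hq k

lemma qp_zero (t : K) : qp t 0 = 1 := by simp [qp]

/-- Gaussian polynomial with natural arguments. -/
lemma gauss_nat (t : K) (m k : ℕ) : gauss t ((m : ℤ) + k) m = qp t (m + k) / (qp t m * qp t k) := by
  have h2 : ((m : ℤ) + k).toNat = m + k := by omega
  have h3 : ((m : ℤ) + k - m).toNat = k := by omega
  rw [gauss, if_pos (by constructor <;> omega), h2, h3]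
  simp

lemma gauss_neg (t : K) {N m : ℤ} (h : m < 0) : gauss t N m = 0 := by
  rw [gauss, if_neg (by omega)]

lemma gauss_gt (t : K) {N m : ℤ} (h : N < m) : gauss t N m = 0 := by
  rw [gauss, if_neg (by omega)]

lemma gauss_symm (t : K) (N m : ℤ) : gauss t N m = gauss t N (N - m) := by
  unfold gauss
  by_cases h : 0 ≤ m ∧ m ≤ N
  · rw [if_pos h, if_pos (by omega), mul_comm (qp t m.toNat)]
    congr 3; simp
  · rw [if_neg h, if_neg (by omega)]

lemma gauss_zero {t : K} (hq : ∀ n : ℕ, 1 - t ^ (4 * (n + 1)) ≠ 0) {N : ℤ} (h : 0 ≤ N) :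
    gauss t N 0 = 1 := by
  obtain ⟨n, rfl⟩ := Int.eq_ofNat_of_zero_le h
  have := gauss_nat t 0 n
  simp only [Nat.cast_zero, zero_add, qp_zero, one_mul] at this
  rw [this, div_self (qp_ne hq n)]

lemma gauss_absorb {t : K} (hq : ∀ n : ℕ, 1 - t ^ (4 * (n + 1)) ≠ 0) (N m : ℤ) :
    (1 - t ^ (4 * m)) * gauss t N m = (1 - t ^ (4 * N)) * gauss t (N - 1) (m - 1) := by
  by_cases hm : m ≤ 0
  · rw [gauss_neg t (show m - 1 < 0 by omega)]
    rcases hm.lt_or_eq with h | h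
    · rw [gauss_neg t h]; simp
    · subst h; simp
  by_cases hN : N < m
  · rw [gauss_gt t hN, gauss_gt t (show N - 1 < m - 1 by omega)]; simp
  obtain ⟨a, rfl⟩ : ∃ a : ℕ, m = (a : ℤ) + 1 := ⟨(m - 1).toNat, by omega⟩
  obtain ⟨b, rfl⟩ : ∃ b : ℕ, N = (a : ℤ) + 1 + b := ⟨(N - (a + 1)).toNat, by omega⟩
  have h1 := gauss_nat t (a + 1) b
  have h2 := gauss_nat t a b
  push_cast at h1
  rw [h1, show (a : ℤ) + 1 + b - 1 = a + b by ring, show (a : ℤ) + 1 - 1 = a by ring, h2,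
    show a + 1 + b = (a + b) + 1 by ring, qp_succ, qp_succ]
  have e1 : t ^ (4 * ((a : ℤ) + 1)) = t ^ (4 * (a + 1)) := by
    rw [← zpow_natCast]; push_cast; rfl
  have e2 : t ^ (4 * ((a : ℤ) + 1 + b)) = t ^ (4 * (a + b + 1)) := by
    rw [← zpow_natCast]; push_cast; congr 1; ring
  rw [e1, e2]
  have := qp_ne hq a
  have := qp_ne hq b
  have := hq a
  field_simp

lemma gauss_pascal {t : K} (ht : t ≠ 0) (hq : ∀ n : ℕ, 1 - t ^ (4 * (n + 1)) ≠ 0) {N : ℤ}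
    (hN : 1 ≤ N) (m : ℤ) :
    gauss t N m = gauss t (N - 1) (m - 1) + t ^ (4 * m) * gauss t (N - 1) m := by
  have h1 := gauss_absorb hq N m
  have h2 := gauss_absorb hq N (N - m)
  rw [← gauss_symm, show N - m - 1 = N - 1 - m by ring, ← gauss_symm] at h2
  have hne : 1 - t ^ (4 * N) ≠ 0 := by
    obtain ⟨n, rfl⟩ : ∃ n : ℕ, N = (n : ℤ) + 1 := ⟨(N - 1).toNat, by omega⟩
    have := hq n
    have e1 : t ^ (4 * ((n : ℤ) + 1)) = t ^ (4 * (n + 1)) := by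
      rw [← zpow_natCast]; push_cast; rfl
    rwa [e1]
  apply mul_left_cancel₀ hne
  have e : t ^ (4 * N) = t ^ (4 * m) * t ^ (4 * (N - m)) := by
    rw [← zpow_add₀ ht]; congr 1; ring
  rw [mul_add, ← h1, mul_left_comm, ← h2, e]
  ring

/-- `[L; (L+s)/2]`, zero if `L+s` is odd. -/
def bet (t : K) (L s : ℤ) : K :=
  if (L + s) % 2 = 0 then gauss t L ((L + s) / 2) else 0

lemma bet_even (t : K) (L m : ℤ) : bet t L (2 * m - L) = gauss t L m := by
  unfold bet
  rw [if_pos (by omega), show (L + (2 * m - L)) / 2 = m by omega]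

lemma bet_odd (t : K) {L s : ℤ} (h : (L + s) % 2 ≠ 0) : bet t L s = 0 := by
  unfold bet
  rw [if_neg h]

lemma bet_zero (t : K) {L s : ℤ} (h : L < s ∨ s < -L) : bet t L s = 0 := by
  by_cases hp : (L + s) % 2 = 0
  · obtain ⟨m, rfl⟩ : ∃ m, s = 2 * m - L := ⟨(L + s) / 2, by omega⟩
    rw [bet_even]
    rcases h with h | h
    · exact gauss_gt t (by omega)
    · exact gauss_neg t (by omega)
  · exact bet_odd t hp

lemma bet_symm (t : K) (L s : ℤ) : bet t L s = bet t L (-s) := by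
  by_cases hp : (L + s) % 2 = 0
  · obtain ⟨m, rfl⟩ : ∃ m, s = 2 * m - L := ⟨(L + s) / 2, by omega⟩
    rw [bet_even, show -(2 * m - L) = 2 * (L - m) - L by ring, bet_even, gauss_symm]
  · rw [bet_odd t hp, bet_odd t (by omega)]

lemma bet_rec {t : K} (ht : t ≠ 0) (hq : ∀ n : ℕ, 1 - t ^ (4 * (n + 1)) ≠ 0) {L : ℤ}
    (hL : 1 ≤ L) (s : ℤ) :
    bet t L s = bet t (L - 1) (s - 1) + bet t (L - 1) (s + 1)
      + (t ^ (4 * (L - 1)) - 1) * bet t (L - 2) s := by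
  by_cases hp : (L + s) % 2 = 0
  · obtain ⟨m, rfl⟩ : ∃ m, s = 2 * m - L := ⟨(L + s) / 2, by omega⟩
    rw [bet_even, show 2 * m - L - 1 = 2 * (m - 1) - (L - 1) by ring, bet_even,
      show 2 * m - L + 1 = 2 * m - (L - 1) by ring, bet_even,
      show 2 * m - L = 2 * (m - 1) - (L - 2) by ring, bet_even, gauss_pascal ht hq hL m]
    have := gauss_absorb hq (L - 1) m
    rw [show L - 1 - 1 = L - 2 by ring] at this
    linear_combination -this
  · rw [bet_odd t hp, bet_odd t (by omega), bet_odd t (by omega), bet_odd t (by omega)]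
    ring

lemma bet_bd {t : K} (ht : t ≠ 0) (hq : ∀ n : ℕ, 1 - t ^ (4 * (n + 1)) ≠ 0) (L s : ℤ) :
    (1 - t ^ (4 * s)) * bet t L s =
      (1 - t ^ (4 * L)) * (bet t (L - 1) (s - 1) - t ^ (4 * s) * bet t (L - 1) (s + 1)) := by
  by_cases hp : (L + s) % 2 = 0
  · obtain ⟨m, rfl⟩ : ∃ m, s = 2 * m - L := ⟨(L + s) / 2, by omega⟩
    rw [bet_even, show 2 * m - L - 1 = 2 * (m - 1) - (L - 1) by ring, bet_even,
      show 2 * m - L + 1 = 2 * m - (L - 1) by ring, bet_even]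
    have h1 := gauss_absorb hq L m
    have h2 := gauss_absorb hq L (L - m)
    rw [← gauss_symm, show L - m - 1 = L - 1 - m by ring, ← gauss_symm] at h2
    have e : t ^ (4 * m) = t ^ (4 * (2 * m - L)) * t ^ (4 * (L - m)) := by
      rw [← zpow_add₀ ht]; congr 1; ring
    rw [e] at h1
    linear_combination h1 - t ^ (4 * (2 * m - L)) * h2
  · rw [bet_odd t hp, bet_odd t (by omega), bet_odd t (by omega)]
    ring

/-- bosonic half sum -/
def SS (t : K) (R b L c : ℤ) : K :=
  ∑ᶠ j : ℤ, t ^ (4 * (R * j ^ 2 + b * j)) * bet t L (c - b - 2 * R * j)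

/-- bosonic sum -/
def BB (t : K) (R b L a : ℤ) : K := SS t R b L a - SS t R b L (-a)

lemma fin_aux (R c L : ℤ) (hR : 1 ≤ R) : {j : ℤ | |c - 2 * R * j| ≤ L}.Finite := by
  apply (Set.finite_Icc (-(|c| + |L|)) (|c| + |L|)).subset
  intro j hj
  have h1 : |2 * R * j| ≤ |c| + |L| := by
    have : |2 * R * j| ≤ |c| + |c - 2 * R * j| := by
      have := abs_sub c (c - 2 * R * j)
      simpa using this
    have h3 : |c - 2 * R * j| ≤ L := hj
    have := le_abs_self L
    omega
  have h2 : |j| ≤ |2 * R * j| := by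
    rw [abs_mul]
    have : 1 ≤ |2 * R| := by rw [abs_of_pos (by omega)]; omega
    nlinarith [abs_nonneg j]
  have := abs_le.1 (h2.trans h1)
  exact ⟨this.1, this.2⟩

lemma SS_fin (t : K) (R b L c : ℤ) (hR : 1 ≤ R) (g : ℤ → K) :
    (Function.support fun j : ℤ => g j * bet t L (c - b - 2 * R * j)).Finite := by
  apply (fin_aux R (c - b) L hR).subset
  intro j hj
  by_contra h
  apply hj
  have h' : L < |c - b - 2 * R * j| := not_le.1 h
  rw [lt_abs] at h'
  simp only
  rw [bet_zero t (by omega), mul_zero]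

lemma SS_rec {t : K} (ht : t ≠ 0) (hq : ∀ n : ℕ, 1 - t ^ (4 * (n + 1)) ≠ 0) {R : ℤ} (hR : 1 ≤ R)
    {L : ℤ} (hL : 1 ≤ L) (b c : ℤ) :
    SS t R b L c = SS t R b (L - 1) (c - 1) + SS t R b (L - 1) (c + 1)
      + (t ^ (4 * (L - 1)) - 1) * SS t R b (L - 2) c := by
  unfold SS
  rw [mul_finsum, ← finsum_add_distrib, ← finsum_add_distrib]
  · apply finsum_congr
    intro j
    rw [bet_rec ht hq hL, show c - b - 2 * R * j - 1 = c - 1 - b - 2 * R * j by ring,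
      show c - b - 2 * R * j + 1 = c + 1 - b - 2 * R * j by ring]
    ring
  · exact (Set.Finite.union (SS_fin t R b (L - 1) (c - 1) hR _) (SS_fin t R b (L - 1) (c + 1) hR _)).subset
      (Function.support_add _ _)
  · simp_rw [← mul_assoc]; exact SS_fin t R b (L - 2) c hR _
  · exact SS_fin t R b (L - 1) (c - 1) hR _
  · exact SS_fin t R b (L - 1) (c + 1) hR _

lemma BB_rec {t : K} (ht : t ≠ 0) (hq : ∀ n : ℕ, 1 - t ^ (4 * (n + 1)) ≠ 0) {R : ℤ} (hR : 1 ≤ R)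
    {L : ℤ} (hL : 1 ≤ L) (b a : ℤ) :
    BB t R b L a = BB t R b (L - 1) (a - 1) + BB t R b (L - 1) (a + 1)
      + (t ^ (4 * (L - 1)) - 1) * BB t R b (L - 2) a := by
  unfold BB
  rw [SS_rec ht hq hR hL b a, SS_rec ht hq hR hL b (-a), show -(a - 1) = -a + 1 by ring,
    show -(a + 1) = -a - 1 by ring]
  ring

lemma BB_zero (t : K) (R b L : ℤ) : BB t R b L 0 = 0 := by simp [BB]

lemma SS_shift (t : K) (R b L c : ℤ) : SS t R b L (c - 2 * R) =
    ∑ᶠ j : ℤ, t ^ (4 * (R * (j - 1) ^ 2 + b * (j - 1))) * bet t L (c - b - 2 * R * j) := by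
  unfold SS
  rw [← finsum_comp_equiv (Equiv.subRight (1 : ℤ))]
  apply finsum_congr
  intro j
  simp only [Equiv.subRight_apply]
  congr 2; ring

lemma BB_bd {t : K} (ht : t ≠ 0) (hq : ∀ n : ℕ, 1 - t ^ (4 * (n + 1)) ≠ 0) {R : ℤ} (hR : 1 ≤ R)
    (L b : ℤ) :
    BB t R b L R = (1 - t ^ (4 * L)) * BB t R b (L - 1) (R - 1) := by
  unfold BB
  rw [show -R = R - 2 * R by ring, show -(R - 1) = (R + 1) - 2 * R by ring, SS_shift, SS_shift]
  unfold SS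
  rw [← finsum_sub_distrib, ← finsum_sub_distrib, mul_finsum]
  · apply finsum_congr
    intro j
    have h := bet_bd ht hq L (R - b - 2 * R * j)
    have e : t ^ (4 * (R * (j - 1) ^ 2 + b * (j - 1))) =
      t ^ (4 * (R * j ^ 2 + b * j)) * t ^ (4 * (R - b - 2 * R * j)) := by
      rw [← zpow_add₀ ht]; congr 1; ring
    rw [e, show R - 1 - b - 2 * R * j = R - b - 2 * R * j - 1 by ring,
      show R + 1 - b - 2 * R * j = R - b - 2 * R * j + 1 by ring]
    linear_combination t ^ (4 * (R * j ^ 2 + b * j)) * h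
  · exact SS_fin t R b (L - 1) (R - 1) hR _
  · exact SS_fin t R b (L - 1) (R + 1) hR _
  · exact SS_fin t R b L R hR _
  · exact SS_fin t R b L R hR _

lemma BB_edge {t : K} (ht : t ≠ 0) (hq : ∀ n : ℕ, 1 - t ^ (4 * (n + 1)) ≠ 0) {R : ℤ} (hR : 1 ≤ R)
    {L : ℤ} (hL : 1 ≤ L) (b : ℤ) :
    BB t R b L (R - 1) = BB t R b (L - 1) (R - 2) := by
  have h1 := BB_rec ht hq hR hL b (R - 1)
  have h2 := BB_bd ht hq hR (L - 1) b
  rw [show R - 1 + 1 = R by ring, h2, show R - 1 - 1 = R - 2 by ring,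
    show L - 1 - 1 = L - 2 by ring] at h1
  rw [h1]; ring

lemma BB_init {t : K} (hq : ∀ n : ℕ, 1 - t ^ (4 * (n + 1)) ≠ 0)
    {R a b : ℤ} (ha : 1 ≤ a) (ha' : a ≤ R - 1) (hb : 1 ≤ b)
    (hb' : b ≤ R - 1) : BB t R b 0 a = if a = b then 1 else 0 := by
  have hb0 : ∀ s : ℤ, s ≠ 0 → bet t 0 s = 0 := fun s hs => bet_zero t (by omega)
  have hb1 : bet t 0 0 = 1 := by
    have := bet_even t 0 0
    simp only [mul_zero, sub_zero] at this
    rw [this, gauss_zero hq le_rfl]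
  have key : ∀ c : ℤ, c ≤ R - 1 → -(R - 1) ≤ c → SS t R b 0 c = if c = b then 1 else 0 := by
    intro c hc hc'
    unfold SS
    rw [finsum_eq_single _ 0]
    · by_cases h : c = b
      · subst h; simp [hb1]
      · rw [if_neg h, hb0 _ (by simpa [sub_eq_zero] using h), mul_zero]
    · intro j hj
      rw [hb0, mul_zero]
      intro h0
      have h1 : 2 * R * j = c - b := by linarith
      rcases lt_or_gt_of_ne hj with h | h
      · nlinarith
      · nlinarith
  unfold BB
  rw [key a ha' (by omega), key (-a) (by omega) (by omega), if_neg (show ¬ -a = b by omega), sub_zero]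

lemma BB_odd (t : K) {R b L a : ℤ} (h : (L + a - b) % 2 ≠ 0) : BB t R b L a = 0 := by
  have key : ∀ c : ℤ, (L + c - b) % 2 ≠ 0 → SS t R b L c = 0 := by
    intro c hc
    unfold SS
    rw [← finsum_zero (α := ℤ)]
    apply finsum_congr
    intro j
    rw [bet_odd, mul_zero]
    rw [show L + (c - b - 2 * R * j) = (L + c - b) + 2 * (- (R * j)) by ring]
    omega
  unfold BB
  rw [key a h, key (-a) (by omega), sub_zero]

lemma gaussHalf_pascal {t : K} (ht : t ≠ 0) (hq : ∀ n : ℕ, 1 - t ^ (4 * (n + 1)) ≠ 0) {N : ℤ}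
    (hN : 1 ≤ N) (m : ℤ) :
    gaussHalf t N m = gaussHalf t (N - 2) (m - 1) + t ^ (4 * m) * gaussHalf t (N - 2) m := by
  unfold gaussHalf
  by_cases h : N % 2 = 0
  · rw [if_pos h, if_pos (by omega), if_pos (by omega), gauss_pascal ht hq (by omega) m,
      show (N - 2) / 2 = N / 2 - 1 by omega]
  · rw [if_neg h, if_neg (by omega), if_neg (by omega)]; ring

lemma gaussHalf_neg (t : K) (N : ℤ) {m : ℤ} (h : m < 0) : gaussHalf t N m = 0 := by
  unfold gaussHalf
  rw [gauss_neg t h]; simp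

lemma gaussHalf_ne (t : K) {N m : ℤ} (h : gaussHalf t N m ≠ 0) : 0 ≤ m ∧ 2 * m ≤ N := by
  unfold gaussHalf gauss at h
  split_ifs at h with h1 h2
  · omega
  · exact absurd rfl h
  · exact absurd rfl h

/-- unit vectors -/
def ee (j i : ℕ) : ℤ := if i = j then 1 else 0

/-- columns of the Cartan matrix -/
def ce (j i : ℕ) : ℤ := 2 * ee j i - ee j (i + 1) - ee (j + 1) i

/-- parity and support restriction -/
def Adm (d : ℕ) (P m : ℕ → ℤ) : Prop :=
  ∀ j, ((1 ≤ j ∧ j ≤ d) → (m j - P j) % 2 = 0) ∧ (¬ (1 ≤ j ∧ j ≤ d) → m j = 0)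

/-- quadratic form -/
def quad (d : ℕ) (m : ℕ → ℤ) : ℤ := ∑ j ∈ Finset.range (d + 1), (m (j + 1) - m j) ^ 2

/-- linear form -/
def lin (d : ℕ) (w m : ℕ → ℤ) : ℤ := ∑ j ∈ Finset.range (d + 2), w j * m j

/-- tops -/
def tp (u w m : ℕ → ℤ) (j : ℕ) : ℤ := m (j - 1) + m (j + 1) + u j + w j

/-- summand -/
def termD (t : K) (d : ℕ) (P u w m : ℕ → ℤ) : K :=
  if Adm d P m then
    t ^ (quad d m - 2 * lin d w m) * ∏ j ∈ Finset.Icc 1 d, gaussHalf t (tp u w m j) (m j)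
  else 0

/-- the dual fermionic sum -/
def DD (t : K) (d : ℕ) (P u w : ℕ → ℤ) : K := ∑ᶠ m : ℕ → ℤ, termD t d P u w m

lemma termD_congr (t : K) {d : ℕ} {P P' u w w' : ℕ → ℤ}
    (h : ∀ x, 1 ≤ x → x ≤ d → (P' x - P x) % 2 = 0 ∧ w' x = w x) (m : ℕ → ℤ) :
    termD t d P u w m = termD t d P' u w' m := by
  unfold termD
  have hA : Adm d P m ↔ Adm d P' m := by
    unfold Adm
    apply forall_congr'
    intro j
    apply and_congr_left
    intro _
    apply forall_congr'
    intro hj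
    have := (h j hj.1 hj.2).1
    omega
  by_cases hm : Adm d P m
  · rw [if_pos hm, if_pos (hA.1 hm)]
    congr 1
    · congr 3
      apply Finset.sum_congr rfl
      intro j _
      by_cases hj : 1 ≤ j ∧ j ≤ d
      · rw [(h j hj.1 hj.2).2]
      · rw [(hm j).2 hj]; simp
    · apply Finset.prod_congr rfl
      intro j hj
      rw [Finset.mem_Icc] at hj
      rw [tp, tp, (h j hj.1 hj.2).2]
  · rw [if_neg hm, if_neg (fun h => hm (hA.2 h))]

lemma DD_congr (t : K) {d : ℕ} {P P' u w w' : ℕ → ℤ}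
    (h : ∀ x, 1 ≤ x → x ≤ d → (P' x - P x) % 2 = 0 ∧ w' x = w x) :
    DD t d P u w = DD t d P' u w' :=
  finsum_congr fun m => termD_congr t h m

lemma termD_ne {t : K} {d : ℕ} {P u w m : ℕ → ℤ} (h : termD t d P u w m ≠ 0) :
    Adm d P m ∧ (∀ j, 1 ≤ j → j ≤ d → 0 ≤ m j ∧ 2 * m j ≤ tp u w m j) := by
  unfold termD at h
  split_ifs at h with hA
  · refine ⟨hA, fun j h1 h2 => ?_⟩
    have := (mul_ne_zero_iff.1 h).2
    rw [Finset.prod_ne_zero_iff] at this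
    exact gaussHalf_ne t (this j (Finset.mem_Icc.2 ⟨h1, h2⟩))
  · exact absurd rfl h

lemma bound_aux {d : ℕ} {m : ℕ → ℤ} {c : ℤ} (hc : 0 ≤ c) (h0 : m 0 = 0) (h1 : m (d + 1) = 0)
    (h : ∀ j, 1 ≤ j → j ≤ d → 2 * m j ≤ m (j - 1) + m (j + 1) + c) :
    ∀ j, j ≤ d + 1 → m j ≤ (c + 1) * ((j : ℤ) * (d + 1 - j)) := by
  obtain ⟨x, hx, hmax⟩ := Finset.exists_max_image (Finset.range (d + 2))
    (fun j : ℕ => m j - (c + 1) * ((j : ℤ) * (d + 1 - j))) ⟨0, by simp⟩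
  have hx0 : m x - (c + 1) * ((x : ℤ) * (d + 1 - x)) ≤ 0 := by
    rw [Finset.mem_range] at hx
    rcases Nat.eq_zero_or_pos x with h2 | h2
    · subst h2; simp [h0]
    rcases Nat.lt_or_ge d x with h3 | h3
    · have : x = d + 1 := by omega
      subst this; simp [h1]
    exfalso
    obtain ⟨y, rfl⟩ : ∃ y, x = y + 1 := ⟨x - 1, by omega⟩
    have a1 := hmax y (by simp; omega)
    have a2 := hmax (y + 1 + 1) (by simp; omega)
    have a3 := h (y + 1) h2 h3
    simp only [Nat.add_sub_cancel] at a3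
    push_cast at a1 a2
    nlinarith
  intro j hj
  have := hmax j (by simp; omega)
  linarith

lemma termD_fin (t : K) (d : ℕ) (P u w : ℕ → ℤ) :
    (Function.support fun m => termD t d P u w m).Finite := by
  obtain ⟨c, hc0, hc⟩ : ∃ c : ℤ, 0 ≤ c ∧ ∀ j, j ≤ d → u j + w j ≤ c := by
    refine ⟨∑ j ∈ Finset.range (d + 1), |u j + w j|, Finset.sum_nonneg fun _ _ => abs_nonneg _, ?_⟩
    intro j hj
    exact (le_abs_self _).trans
      (Finset.single_le_sum (f := fun j => |u j + w j|) (fun _ _ => abs_nonneg _) (by simp; omega))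
  have hfin : {f : Fin (d + 1) → ℤ | ∀ j, f j ∈ Set.Icc 0 ((c + 1) * ((d + 1) * (d + 1)))}.Finite :=
    Set.Finite.pi' fun _ => Set.finite_Icc _ _
  apply (hfin.image (fun f (j : ℕ) => if h : j < d + 1 then f ⟨j, h⟩ else 0)).subset
  intro m hm
  obtain ⟨hA, hb⟩ := termD_ne hm
  refine ⟨fun j => m j, ?_, ?_⟩
  · have h0 := (hA 0).2 (by omega)
    have h1 := (hA (d + 1)).2 (by omega)
    have hB := bound_aux (d := d) (m := m) hc0 h0 h1 (by
      intro j h1 h2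
      have a := (hb j h1 h2).2
      have b := hc j h2
      unfold tp at a
      omega)
    intro j
    have hj := j.2
    constructor
    · by_cases h : 1 ≤ (j : ℕ) ∧ (j : ℕ) ≤ d
      · exact (hb j h.1 h.2).1
      · simp only [(hA j).2 h]; exact le_rfl
    · refine (hB j (by omega)).trans ?_
      apply mul_le_mul_of_nonneg_left _ (by omega)
      apply mul_le_mul <;> omega
  · funext j
    simp only
    split_ifs with h
    · rfl
    · exact ((hA j).2 (by omega)).symm

lemma quad_shift {d j : ℕ} (h1 : 1 ≤ j) (h2 : j ≤ d) (m : ℕ → ℤ) :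
    quad d (m - ee j) = quad d m - 2 * (2 * m j - m (j - 1) - m (j + 1)) + 2 := by
  obtain ⟨y, rfl⟩ : ∃ y, j = y + 1 := ⟨j - 1, by omega⟩
  have : quad d (m - ee (y + 1)) - quad d m =
      ∑ i ∈ Finset.range (d + 1), ((if i = y then (-2 * (m (y + 1) - m y) + 1) else 0)
        + if i = y + 1 then 2 * (m (y + 1 + 1) - m (y + 1)) + 1 else 0) := by
    unfold quad
    rw [← Finset.sum_sub_distrib]
    apply Finset.sum_congr rfl
    intro i _
    simp only [Pi.sub_apply, ee]
    by_cases e1 : i = y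
    · subst e1; simp; ring
    · by_cases e2 : i = y + 1
      · subst e2; simp; ring
      · simp [e1, e2]
  rw [Finset.sum_add_distrib, Finset.sum_ite_eq', Finset.sum_ite_eq', if_pos (by simp; omega),
    if_pos (by simp; omega)] at this
  simp only [Nat.add_sub_cancel]
  linarith

lemma sum_ee {n j : ℕ} (hj : j < n) (f : ℕ → ℤ) : ∑ i ∈ Finset.range n, ee j i * f i = f j := by
  simp [ee, hj]

lemma lin_shift {d j : ℕ} (h1 : 1 ≤ j) (h2 : j ≤ d) (w m : ℕ → ℤ) :
    lin d (w - ce j) (m - ee j) = lin d w m - (2 * m j - m (j - 1) - m (j + 1)) - w j + 2 := by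
  obtain ⟨y, rfl⟩ : ∃ y, j = y + 1 := ⟨j - 1, by omega⟩
  have key : ∀ i, (w - ce (y + 1)) i * (m - ee (y + 1)) i = w i * m i - 2 * (ee (y + 1) i * m i)
      + ee y i * m i + ee (y + 1 + 1) i * m i - ee (y + 1) i * w i + ee (y + 1) i * 2 := by
    intro i
    simp only [Pi.sub_apply, ce, ee]
    by_cases e1 : i = y
    · subst e1
      have e4 : ¬ (i = i + 1 + 1) := by omega
      simp [e4]; ring
    · by_cases e2 : i = y + 1
      · subst e2; simp; ring
      · by_cases e3 : i = y + 1 + 1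
        · subst e3; simp [e1]; ring
        · simp [e1, e2, e3]
  unfold lin
  simp only [key, Finset.sum_add_distrib, Finset.sum_sub_distrib, ← Finset.mul_sum]
  rw [sum_ee (by omega), sum_ee (by omega), sum_ee (by omega), sum_ee (by omega)]
  rw [sum_ee (by omega) (fun _ => 2)]
  simp only [Nat.add_sub_cancel]
  ring

lemma lin_sub {d j : ℕ} (h2 : j ≤ d) (w m : ℕ → ℤ) :
    lin d (w - 2 * ee j) m = lin d w m - 2 * m j := by
  unfold lin
  have key : ∀ i, (w - 2 * ee j) i * m i = w i * m i - 2 * (ee j i * m i) := by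
    intro i; simp; ring
  simp only [key, Finset.sum_sub_distrib, ← Finset.mul_sum]
  rw [sum_ee (by omega)]

lemma Adm_shift {d j : ℕ} (h1 : 1 ≤ j) (h2 : j ≤ d) (P m : ℕ → ℤ) :
    Adm d (P + ee j) (m - ee j) ↔ Adm d P m := by
  unfold Adm
  apply forall_congr'
  intro i
  simp only [Pi.add_apply, Pi.sub_apply, ee]
  split_ifs with h
  · subst h; constructor <;> intro h3 <;> constructor <;> intro h4 <;> omega
  · constructor <;> intro h3 <;> constructor <;> intro h4 <;> have := h3.1 <;> have := h3.2 <;> omega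

lemma termD_node {t : K} (ht : t ≠ 0) (hq : ∀ n : ℕ, 1 - t ^ (4 * (n + 1)) ≠ 0) {d j : ℕ}
    (h1 : 1 ≤ j) (h2 : j ≤ d) (P u w : ℕ → ℤ) (hu : ∀ i, 0 ≤ u i) (hw : 1 ≤ w j) (m : ℕ → ℤ) :
    termD t d P u w m = termD t d P u (w - 2 * ee j) m +
      t ^ (2 * (1 - w j)) * termD t d (P + ee j) u (w - ce j) (m - ee j) := by
  unfold termD
  by_cases hA : Adm d P m
  swap
  · rw [if_neg hA, if_neg hA, if_neg (fun h => hA ((Adm_shift h1 h2 P m).1 h))]; simp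
  rw [if_pos hA, if_pos hA, if_pos ((Adm_shift h1 h2 P m).2 hA)]
  have hj : j ∈ Finset.Icc 1 d := Finset.mem_Icc.2 ⟨h1, h2⟩
  rw [← Finset.mul_prod_erase _ _ hj, ← Finset.mul_prod_erase _ _ hj, ← Finset.mul_prod_erase _ _ hj]
  have p1 : ∏ x ∈ (Finset.Icc 1 d).erase j, gaussHalf t (tp u (w - 2 * ee j) m x) (m x) =
      ∏ x ∈ (Finset.Icc 1 d).erase j, gaussHalf t (tp u w m x) (m x) := by
    apply Finset.prod_congr rfl
    intro x hx
    have hxj := Finset.ne_of_mem_erase hx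
    congr 1
    simp [tp, ee, hxj]
  have p2 : ∏ x ∈ (Finset.Icc 1 d).erase j, gaussHalf t (tp u (w - ce j) (m - ee j) x) ((m - ee j) x) =
      ∏ x ∈ (Finset.Icc 1 d).erase j, gaussHalf t (tp u w m x) (m x) := by
    apply Finset.prod_congr rfl
    intro x hx
    have hxj := Finset.ne_of_mem_erase hx
    have hx1 := (Finset.mem_Icc.1 (Finset.mem_of_mem_erase hx)).1
    obtain ⟨y, rfl⟩ : ∃ y, x = y + 1 := ⟨x - 1, by omega⟩
    congr 1
    · simp only [tp, ee, ce, Pi.sub_apply, Nat.add_sub_cancel]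
      split_ifs <;> omega
    · simp [ee, hxj]
  rw [p1, p2]
  by_cases hneg : ∃ x ∈ (Finset.Icc 1 d).erase j, m x < 0
  · obtain ⟨x, hx, hx0⟩ := hneg
    have : ∏ x ∈ (Finset.Icc 1 d).erase j, gaussHalf t (tp u w m x) (m x) = 0 :=
      Finset.prod_eq_zero hx (gaussHalf_neg t _ hx0)
    rw [this]; ring
  push Not at hneg
  have hpos : ∀ x, x ≠ j → 0 ≤ m x := by
    intro x hx
    by_cases hx1 : 1 ≤ x ∧ x ≤ d
    · exact hneg x (Finset.mem_erase.2 ⟨hx, Finset.mem_Icc.2 hx1⟩)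
    · rw [(hA x).2 hx1]
  have htop : 1 ≤ tp u w m j := by
    have a1 := hpos (j - 1) (by omega)
    have a2 := hpos (j + 1) (by omega)
    have a3 := hu j
    unfold tp
    omega
  have t1 : tp u (w - 2 * ee j) m j = tp u w m j - 2 := by
    simp [tp, ee]; ring
  have t2 : tp u (w - ce j) (m - ee j) j = tp u w m j - 2 := by
    have e1 : ¬ (j - 1 = j) := by omega
    simp [tp, ee, ce, e1]; ring
  have t3 : (m - ee j) j = m j - 1 := by simp [ee]
  rw [t1, t2, t3, gaussHalf_pascal ht hq htop, lin_sub h2, lin_shift h1 h2, quad_shift h1 h2]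
  have e1 : t ^ (quad d m - 2 * (lin d w m - 2 * m j)) = t ^ (quad d m - 2 * lin d w m) * t ^ (4 * m j) := by
    rw [← zpow_add₀ ht]; congr 1; ring
  have e2 : t ^ (quad d m - 2 * lin d w m) = t ^ (2 * (1 - w j)) *
      t ^ (quad d m - 2 * (2 * m j - m (j - 1) - m (j + 1)) + 2 -
        2 * (lin d w m - (2 * m j - m (j - 1) - m (j + 1)) - w j + 2)) := by
    rw [← zpow_add₀ ht]; congr 1; ring
  rw [e1, ← mul_assoc (t ^ (2 * (1 - w j))), ← e2]
  ring

lemma DD_node {t : K} (ht : t ≠ 0) (hq : ∀ n : ℕ, 1 - t ^ (4 * (n + 1)) ≠ 0) {d j : ℕ}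
    (h1 : 1 ≤ j) (h2 : j ≤ d) (P u w : ℕ → ℤ) (hu : ∀ i, 0 ≤ u i) (hw : 1 ≤ w j)
    {w' w'' P'' : ℕ → ℤ} (hw' : ∀ x, 1 ≤ x → x ≤ d → w' x = w x - 2 * ee j x)
    (hw'' : ∀ x, 1 ≤ x → x ≤ d → (P'' x - P x - ee j x) % 2 = 0 ∧ w'' x = w x - ce j x) :
    DD t d P u w = DD t d P u w' + t ^ (2 * (1 - w j)) * DD t d P'' u w'' := by
  have e1 : DD t d P u w' = DD t d P u (w - 2 * ee j) := by
    apply DD_congr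
    intro x a b
    refine ⟨by simp, ?_⟩
    rw [hw' x a b]; simp
  have e2 : DD t d P'' u w'' = DD t d (P + ee j) u (w - ce j) := by
    apply DD_congr
    intro x a b
    have := hw'' x a b
    refine ⟨?_, ?_⟩
    · simp only [Pi.add_apply]; omega
    · rw [this.2]; simp
  rw [e1, e2]
  unfold DD
  rw [← finsum_comp_equiv (Equiv.subRight (ee j)) (f := termD t d (P + ee j) u (w - ce j)), mul_finsum,
    ← finsum_add_distrib]
  · exact finsum_congr fun m => termD_node ht hq h1 h2 P u w hu hw m
  · exact termD_fin t d _ _ _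
  · have := (termD_fin t d (P + ee j) u (w - ce j)).preimage
      ((Equiv.subRight (ee j)).injective.injOn)
    apply this.subset
    intro m hm
    exact (mul_ne_zero_iff.1 hm).2

/-- parity after the first nodes were shifted -/
def PP (P : ℕ → ℤ) (i x : ℕ) : ℤ := P x + if x < i then 1 else 0

/-- weight `c e_1` -/
def cw (c : ℤ) (x : ℕ) : ℤ := if x = 1 then c else 0

/-- weights of the first chain -/
def Yw (L : ℤ) (k i x : ℕ) : ℤ := cw (L - 1) x - ee i (x + 1) + ee i x + ee k x
/-- weights of the remainders -/
def Rw (L : ℤ) (k i x : ℕ) : ℤ := cw (L - 1) x - ee i (x + 1) - ee i x + ee k x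
/-- weights of the second chain -/
def Vw (L : ℤ) (k i x : ℕ) : ℤ := cw (L - 1) x + ee i x - ee (i + 1) x + ee k x
/-- basic weights -/
def Bw (L : ℤ) (k x : ℕ) : ℤ := cw L x + ee k x

lemma stepY {t : K} (ht : t ≠ 0) (hq : ∀ n : ℕ, 1 - t ^ (4 * (n + 1)) ≠ 0) {d i k : ℕ} {L : ℤ}
    (h1 : 2 ≤ i) (h2 : i ≤ d) (h3 : i < k) (P u : ℕ → ℤ) (hu : ∀ i, 0 ≤ u i) :
    DD t d (PP P i) u (Yw L k i) =
      DD t d (PP P i) u (Rw L k i) + DD t d (PP P (i + 1)) u (Yw L k (i + 1)) := by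
  have hw : Yw L k i i = 1 := by
    simp only [Yw, cw, ee]; split_ifs <;> omega
  have := DD_node ht hq (show 1 ≤ i by omega) h2 (PP P i) u (Yw L k i) hu (by omega)
    (w' := Rw L k i) (w'' := Yw L k (i + 1)) (P'' := PP P (i + 1))
    (by intro x _ _; simp only [Yw, Rw, cw, ee]; split_ifs <;> omega)
    (by
      intro x _ _
      constructor
      · simp only [PP, ee]; split_ifs <;> omega
      · simp only [Yw, cw, ce, ee]; split_ifs <;> omega)
  rw [this, hw]; simp

lemma stepV {t : K} (ht : t ≠ 0) (hq : ∀ n : ℕ, 1 - t ^ (4 * (n + 1)) ≠ 0) {d i k : ℕ} {L : ℤ}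
    (h1 : 2 ≤ i) (h2 : i ≤ d) (h3 : i < k) (P u : ℕ → ℤ) (hu : ∀ i, 0 ≤ u i) :
    DD t d (PP P (i + 1)) u (Vw L k i) =
      DD t d (PP P (i + 1)) u (Rw L k (i + 1)) + DD t d (PP P i) u (Vw L k (i - 1)) := by
  have hw : Vw L k i i = 1 := by
    simp only [Vw, cw, ee]; split_ifs <;> omega
  have := DD_node ht hq (show 1 ≤ i by omega) h2 (PP P (i + 1)) u (Vw L k i) hu (by omega)
    (w' := Rw L k (i + 1)) (w'' := Vw L k (i - 1)) (P'' := PP P i)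
    (by intro x _ _; simp only [Vw, Rw, cw, ee]; split_ifs <;> omega)
    (by
      intro x _ _
      constructor
      · simp only [PP, ee]; split_ifs <;> omega
      · simp only [Vw, cw, ce, ee]; split_ifs <;> omega)
  rw [this, hw]; simp

lemma stepV1 {t : K} (ht : t ≠ 0) (hq : ∀ n : ℕ, 1 - t ^ (4 * (n + 1)) ≠ 0) {d k : ℕ} {L : ℤ}
    (hL : 1 ≤ L) (h2 : 1 ≤ d) (h3 : 2 ≤ k) (P u : ℕ → ℤ) (hu : ∀ i, 0 ≤ u i) :
    DD t d (PP P 2) u (Vw L k 1) =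
      DD t d (PP P 2) u (Rw L k 2) + t ^ (2 * (1 - L)) * DD t d P u (Bw (L - 2) k) := by
  have hw : Vw L k 1 1 = L := by
    simp only [Vw, cw, ee]; split_ifs <;> omega
  have := DD_node ht hq (show 1 ≤ 1 by omega) h2 (PP P 2) u (Vw L k 1) hu (by omega)
    (w' := Rw L k 2) (w'' := Bw (L - 2) k) (P'' := P)
    (by intro x _ _; simp only [Vw, Rw, cw, ee]; split_ifs <;> omega)
    (by
      intro x _ _
      constructor
      · simp only [PP, ee]; split_ifs <;> omega
      · simp only [Vw, Bw, cw, ce, ee]; split_ifs <;> omega)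
  rw [this, hw]

lemma stepTop {t : K} (ht : t ≠ 0) (hq : ∀ n : ℕ, 1 - t ^ (4 * (n + 1)) ≠ 0) {d k : ℕ} {L : ℤ}
    (hL : 1 ≤ L) (h2 : 1 ≤ d) (h3 : 2 ≤ k) (P u : ℕ → ℤ) (hu : ∀ i, 0 ≤ u i) :
    DD t d P u (Bw L k) =
      DD t d P u (Bw (L - 2) k) + t ^ (2 * (1 - L)) * DD t d (PP P 2) u (Yw L k 2) := by
  have hw : Bw L k 1 = L := by
    simp only [Bw, cw, ee]; split_ifs <;> omega
  have := DD_node ht hq (show 1 ≤ 1 by omega) h2 P u (Bw L k) hu (by omega)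
    (w' := Bw (L - 2) k) (w'' := Yw L k 2) (P'' := PP P 2)
    (by intro x _ _; simp only [Bw, cw, ee]; split_ifs <;> omega)
    (by
      intro x _ _
      constructor
      · simp only [PP, ee]; split_ifs <;> omega
      · simp only [Yw, Bw, cw, ce, ee]; split_ifs <;> omega)
  rw [this, hw]

lemma stepEnd {t : K} (ht : t ≠ 0) (hq : ∀ n : ℕ, 1 - t ^ (4 * (n + 1)) ≠ 0) {d k : ℕ} {L : ℤ}
    (h2 : k ≤ d) (h3 : 2 ≤ k) (P u : ℕ → ℤ) (hu : ∀ i, 0 ≤ u i) :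
    DD t d (PP P k) u (Yw L k k) =
      DD t d (PP P k) u (Rw L k k) + t ^ (-2 : ℤ) * DD t d (PP P (k + 1)) u (Bw (L - 1) (k + 1)) := by
  have hw : Yw L k k k = 2 := by
    simp only [Yw, cw, ee]; split_ifs <;> omega
  have := DD_node ht hq (show 1 ≤ k by omega) h2 (PP P k) u (Yw L k k) hu (by omega)
    (w' := Rw L k k) (w'' := Bw (L - 1) (k + 1)) (P'' := PP P (k + 1))
    (by intro x _ _; simp only [Yw, Rw, cw, ee]; split_ifs <;> omega)
    (by
      intro x _ _
      constructor
      · simp only [PP, ee]; split_ifs <;> omega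
      · simp only [Yw, Bw, cw, ce, ee]; split_ifs <;> omega)
  rw [this, hw]; norm_num

lemma stepEnd' (t : K) {d k : ℕ} {L : ℤ} (h2 : k = d + 1) (P u : ℕ → ℤ) :
    DD t d (PP P k) u (Yw L k k) = DD t d (PP P k) u (Rw L k k) := by
  apply DD_congr
  intro x h3 h4
  refine ⟨by simp, ?_⟩
  simp only [Yw, Rw, cw, ee]; split_ifs <;> omega

lemma chain {t : K} (ht : t ≠ 0) (hq : ∀ n : ℕ, 1 - t ^ (4 * (n + 1)) ≠ 0) {d k : ℕ} {L : ℤ}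
    (hL : 1 ≤ L) (h3 : 2 ≤ k) (h4 : k ≤ d + 1) (P u : ℕ → ℤ) (hu : ∀ i, 0 ≤ u i) :
    DD t d (PP P 2) u (Yw L k 2) + t ^ (2 * (1 - L)) * DD t d P u (Bw (L - 2) k) =
      (DD t d (PP P k) u (Yw L k k) - DD t d (PP P k) u (Rw L k k))
        + DD t d (PP P k) u (Bw (L - 1) (k - 1)) := by
  have hV1 := stepV1 ht hq hL (show 1 ≤ d by omega) h3 P u hu
  have inv : ∀ i, 2 ≤ i → i ≤ k →
      DD t d (PP P 2) u (Yw L k 2) + t ^ (2 * (1 - L)) * DD t d P u (Bw (L - 2) k) =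
      DD t d (PP P i) u (Yw L k i) - DD t d (PP P i) u (Rw L k i)
        + DD t d (PP P i) u (Vw L k (i - 1)) := by
    intro i hi
    induction i, hi using Nat.le_induction with
    | base => intro _; rw [hV1]; ring
    | succ i hi ih =>
      intro hik
      rw [ih (by omega), stepY ht hq hi (by omega) (by omega) P u hu, Nat.add_sub_cancel,
        stepV ht hq hi (by omega) (show i < k by omega) P u hu]
      ring
  rw [inv k h3 le_rfl]
  congr 1
  apply DD_congr
  intro x _ _
  refine ⟨by simp, ?_⟩
  simp only [Vw, Bw, cw, ee]; split_ifs <;> omega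

/-- parity vector `Q` -/
def QQ (k l x : ℕ) : ℤ := (max k x : ℕ) + (max l x : ℕ)

lemma ferm_rec {t : K} (ht : t ≠ 0) (hq : ∀ n : ℕ, 1 - t ^ (4 * (n + 1)) ≠ 0) {d k : ℕ} {L : ℤ}
    (hL : 1 ≤ L) (h3 : 2 ≤ k) (h4 : k ≤ d) (l : ℕ) :
    DD t d (QQ k l) (ee l) (Bw L k) =
      t ^ (-2 * L) * DD t d (QQ (k + 1) l) (ee l) (Bw (L - 1) (k + 1)) +
      t ^ (2 * (1 - L)) * DD t d (QQ (k - 1) l) (ee l) (Bw (L - 1) (k - 1)) +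
      (1 - t ^ (4 * (1 - L))) * DD t d (QQ k l) (ee l) (Bw (L - 2) k) := by
  have hu : ∀ i, 0 ≤ ee l i := by intro i; unfold ee; split_ifs <;> omega
  have a1 := stepTop ht hq hL (show 1 ≤ d by omega) h3 (QQ k l) (ee l) hu
  have a2 := chain ht hq hL h3 (show k ≤ d + 1 by omega) (QQ k l) (ee l) hu
  have a3 := stepEnd ht hq (L := L) h4 h3 (QQ k l) (ee l) hu
  have e1 : DD t d (PP (QQ k l) k) (ee l) (Bw (L - 1) (k - 1)) =
      DD t d (QQ (k - 1) l) (ee l) (Bw (L - 1) (k - 1)) := by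
    apply DD_congr; intro x _ _; refine ⟨?_, rfl⟩
    simp only [PP, QQ]; split_ifs <;> omega
  have e2 : DD t d (PP (QQ k l) (k + 1)) (ee l) (Bw (L - 1) (k + 1)) =
      DD t d (QQ (k + 1) l) (ee l) (Bw (L - 1) (k + 1)) := by
    apply DD_congr; intro x _ _; refine ⟨?_, rfl⟩
    simp only [PP, QQ]; split_ifs <;> omega
  rw [e1] at a2
  rw [e2] at a3
  have t1 : t ^ (-2 * L) = t ^ (2 * (1 - L)) * t ^ (-2 : ℤ) := by
    rw [← zpow_add₀ ht]; congr 1; ring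
  have t2 : t ^ (4 * (1 - L)) = t ^ (2 * (1 - L)) * t ^ (2 * (1 - L)) := by
    rw [← zpow_add₀ ht]; congr 1; ring
  rw [t1, t2, a1]
  linear_combination t ^ (2 * (1 - L)) * a2 + t ^ (2 * (1 - L)) * a3

lemma ferm_rec_end {t : K} (ht : t ≠ 0) (hq : ∀ n : ℕ, 1 - t ^ (4 * (n + 1)) ≠ 0) {d k : ℕ} {L : ℤ}
    (hL : 1 ≤ L) (h3 : 2 ≤ k) (h4 : k = d + 1) (l : ℕ) :
    DD t d (QQ k l) (ee l) (Bw L k) =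
      t ^ (2 * (1 - L)) * DD t d (QQ (k - 1) l) (ee l) (Bw (L - 1) (k - 1)) +
      (1 - t ^ (4 * (1 - L))) * DD t d (QQ k l) (ee l) (Bw (L - 2) k) := by
  have hu : ∀ i, 0 ≤ ee l i := by intro i; unfold ee; split_ifs <;> omega
  have a1 := stepTop ht hq hL (show 1 ≤ d by omega) h3 (QQ k l) (ee l) hu
  have a2 := chain ht hq hL h3 (show k ≤ d + 1 by omega) (QQ k l) (ee l) hu
  have a3 := stepEnd' t (L := L) h4 (QQ k l) (ee l)
  have e1 : DD t d (PP (QQ k l) k) (ee l) (Bw (L - 1) (k - 1)) =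
      DD t d (QQ (k - 1) l) (ee l) (Bw (L - 1) (k - 1)) := by
    apply DD_congr; intro x _ _; refine ⟨?_, rfl⟩
    simp only [PP, QQ]; split_ifs <;> omega
  rw [e1] at a2
  have t2 : t ^ (4 * (1 - L)) = t ^ (2 * (1 - L)) * t ^ (2 * (1 - L)) := by
    rw [← zpow_add₀ ht]; congr 1; ring
  rw [t2, a1]
  linear_combination t ^ (2 * (1 - L)) * a2 + t ^ (2 * (1 - L)) * a3

lemma ferm_rec_one {t : K} (ht : t ≠ 0) (hq : ∀ n : ℕ, 1 - t ^ (4 * (n + 1)) ≠ 0) {d : ℕ} {L : ℤ}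
    (hL : 1 ≤ L) (h4 : 1 ≤ d) (l : ℕ) :
    DD t d (QQ 1 l) (ee l) (Bw L 1) =
      t ^ (-2 * L) * DD t d (QQ 2 l) (ee l) (Bw (L - 1) 2) +
      DD t d (QQ 0 l) (ee l) (Bw (L - 1) 0) := by
  have hu : ∀ i, 0 ≤ ee l i := by intro i; unfold ee; split_ifs <;> omega
  have hw : Bw L 1 1 = L + 1 := by
    simp only [Bw, cw, ee]; split_ifs <;> omega
  have := DD_node ht hq (show 1 ≤ 1 by omega) h4 (QQ 1 l) (ee l) (Bw L 1) hu (by omega)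
    (w' := Bw (L - 1) 0) (w'' := Bw (L - 1) 2) (P'' := QQ 2 l)
    (by intro x _ _; simp only [Bw, cw, ee]; split_ifs <;> omega)
    (by
      intro x _ _
      constructor
      · simp only [QQ, ee]; split_ifs <;> omega
      · simp only [Bw, cw, ce, ee]; split_ifs <;> omega)
  have e1 : DD t d (QQ 1 l) (ee l) (Bw (L - 1) 0) = DD t d (QQ 0 l) (ee l) (Bw (L - 1) 0) := by
    apply DD_congr; intro x _ _; refine ⟨?_, rfl⟩
    simp only [QQ]; omega
  rw [this, hw, e1, show 2 * (1 - (L + 1)) = -2 * L by ring]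
  ring

lemma ferm_zero (t : K) {d : ℕ} (L : ℤ) (l : ℕ) :
    DD t d (QQ 0 l) (ee l) (Bw L 0) = DD t d (QQ 1 l) (ee l) (Bw (L - 1) 1) := by
  apply DD_congr; intro x _ _
  constructor
  · simp only [QQ]; omega
  · simp only [Bw, cw, ee]; split_ifs <;> omega

lemma uniq_aux {d k l : ℕ} (hkl : k ≤ l) (hl : l ≤ d + 1) (hp : (k + l) % 2 = 0) {m : ℕ → ℤ}
    (hA : Adm d (QQ k l) m) (hpos : ∀ j, 0 ≤ m j)
    (hc : ∀ j, 1 ≤ j → j ≤ d → 2 * m j ≤ m (j - 1) + m (j + 1) + (ee l j + ee k j)) :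
    k = l ∧ m = 0 := by
  have h0 : m 0 = 0 := (hA 0).2 (by omega)
  have hd : m (d + 1) = 0 := (hA (d + 1)).2 (by omega)
  have hcv : ∀ j, 1 ≤ j → j ≤ d → j ≠ k → j ≠ l → 2 * m j ≤ m (j - 1) + m (j + 1) := by
    intro j h1 h2 h3 h4
    have := hc j h1 h2
    simpa [ee, h3, h4] using this
  have left : ∀ j, j < k → m j ≤ m (j + 1) ∧ (0 < m (j + 1) → m j < m (j + 1)) := by
    intro j
    induction j with
    | zero => intro _; have := hpos (0 + 1); omega
    | succ j ih =>
      intro hj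
      have a := ih (by omega)
      have b := hcv (j + 1) (by omega) (by omega) (by omega) (by omega)
      rw [Nat.add_sub_cancel] at b
      have := hpos (j + 1)
      have := hpos (j + 1 + 1)
      omega
  have right : ∀ x, l ≤ x → m x ≤ m (x + 1) → ∀ j, x ≤ j → j ≤ d → m x ≤ m j ∧ m j ≤ m (j + 1) := by
    intro x hx hx1 j hj
    induction j, hj using Nat.le_induction with
    | base => intro _; omega
    | succ j hj ih =>
      intro hjd
      have a := ih (by omega)
      have b := hcv (j + 1) (by omega) (by omega) (by omega) (by omega)
      rw [Nat.add_sub_cancel] at b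
      omega
  rcases hkl.lt_or_eq with h | h
  · exfalso
    have hk1 : m k + 1 ≤ m (k + 1) := by
      have p1 : m k % 2 = 0 := by
        by_cases hk0 : k = 0
        · rw [hk0, h0]; rfl
        · have := (hA k).1 (by omega)
          simp only [QQ] at this
          omega
      have p2 : m (k + 1) % 2 = 1 := by
        by_cases hk0 : k + 1 = d + 1
        · omega
        · have := (hA (k + 1)).1 (by omega)
          simp only [QQ] at this
          omega
      have : m k ≤ m (k + 1) := by
        by_cases hk0 : k = 0
        · rw [hk0, h0]; exact hpos _
        · have a := hc k (by omega) (by omega)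
          have b := left (k - 1) (by omega)
          rw [show k - 1 + 1 = k by omega] at b
          have e : ee l k + ee k k = 1 := by
            simp only [ee]; split_ifs <;> omega
          have := hpos (k + 1)
          have := hpos k
          omega
      omega
    have mid : ∀ j, k ≤ j → j < l → m j + 1 ≤ m (j + 1) := by
      intro j hj
      induction j, hj using Nat.le_induction with
      | base => intro _; exact hk1
      | succ j hj ih =>
        intro hjl
        have a := ih (by omega)
        have b := hcv (j + 1) (by omega) (by omega) (by omega) (by omega)
        rw [Nat.add_sub_cancel] at b
        omega
    have ml := mid (l - 1) (by omega) (by omega)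
    rw [show l - 1 + 1 = l by omega] at ml
    have := hpos (l - 1)
    by_cases hld : l = d + 1
    · have h9 := hpos (d + 1 - 1)
      rw [hld, hd] at ml; omega
    · have a := hc l (by omega) (by omega)
      have e : ee l l + ee k l = 1 := by
        simp only [ee]; split_ifs <;> omega
      have := right l le_rfl (by omega) d (by omega) le_rfl
      omega
  · refine ⟨h, ?_⟩
    subst h
    have hev : ∀ j, m j % 2 = 0 := by
      intro j
      by_cases hj : 1 ≤ j ∧ j ≤ d
      · have := (hA j).1 hj
        simp only [QQ] at this
        omega
      · rw [(hA j).2 hj]; rfl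
    have mk : m k = 0 := by
      by_contra hne
      have hk : 1 ≤ k ∧ k ≤ d := by
        by_contra hk; exact hne ((hA k).2 hk)
      have a := hc k hk.1 hk.2
      have b := left (k - 1) (by omega)
      rw [show k - 1 + 1 = k by omega] at b
      have e : ee k k + ee k k = 2 := by simp [ee]
      have p0 := hpos k
      have p1 := hev k
      have p2 := hev (k - 1)
      have := right k le_rfl (by omega) d (by omega) le_rfl
      omega
    have lz : ∀ n, n ≤ k → m (k - n) = 0 := by
      intro n
      induction n with
      | zero => intro _; simpa using mk
      | succ n ih =>
        intro hn
        have a := ih (by omega)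
        have b := left (k - (n + 1)) (by omega)
        rw [show k - (n + 1) + 1 = k - n by omega] at b
        have := hpos (k - (n + 1))
        omega
    funext j
    simp only [Pi.zero_apply]
    rcases Nat.lt_or_ge k j with hj | hj
    · by_cases hjd : j ≤ d
      · have r := right k le_rfl (by rw [mk]; exact hpos _)
        have hh : ∀ n, n ≤ d + 1 - j → m (d + 1 - n) = 0 := by
          intro n
          induction n with
          | zero => intro _; simpa using hd
          | succ n ih =>
            intro hn
            have a := ih (by omega)
            have b := (r (d + 1 - (n + 1)) (by omega) (by omega)).2
            rw [show d + 1 - (n + 1) + 1 = d + 1 - n by omega] at b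
            have := hpos (d + 1 - (n + 1))
            omega
        have := hh (d + 1 - j) le_rfl
        rwa [show d + 1 - (d + 1 - j) = j by omega] at this
      · exact (hA j).2 (by omega)
    · have := lz (k - j) (by omega)
      rwa [show k - (k - j) = j by omega] at this

lemma ferm_init {t : K} (hq : ∀ n : ℕ, 1 - t ^ (4 * (n + 1)) ≠ 0) {d k l : ℕ} (hk : k ≤ d + 1)
    (hl : l ≤ d + 1) (hp : (k + l) % 2 = 0) :
    DD t d (QQ k l) (ee l) (Bw 0 k) = if k = l then 1 else 0 := by
  have key : ∀ m, termD t d (QQ k l) (ee l) (Bw 0 k) m ≠ 0 → k = l ∧ m = 0 := by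
    intro m hm
    obtain ⟨hA, hb⟩ := termD_ne hm
    have hpos : ∀ j, 0 ≤ m j := by
      intro j
      by_cases h : 1 ≤ j ∧ j ≤ d
      · exact (hb j h.1 h.2).1
      · rw [(hA j).2 h]
    have hc : ∀ j, 1 ≤ j → j ≤ d → 2 * m j ≤ m (j - 1) + m (j + 1) + (ee l j + ee k j) := by
      intro j h1 h2
      have := (hb j h1 h2).2
      simp only [tp, Bw, cw, ite_self] at this
      omega
    rcases le_total k l with h | h
    · exact uniq_aux h hl hp hA hpos hc
    · have := uniq_aux h hk (by omega) (m := m) (by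
        have e : QQ l k = QQ k l := by funext x; simp only [QQ]; ring
        rw [e]; exact hA) hpos (by
        intro j h1 h2; have := hc j h1 h2; omega)
      exact ⟨this.1.symm, this.2⟩
  unfold DD
  rw [finsum_eq_single _ 0]
  · by_cases h : k = l
    · subst h
      have hA : Adm d (QQ k k) 0 := by
        intro j
        simp only [QQ, Pi.zero_apply]
        refine ⟨fun _ => by omega, fun _ => trivial⟩
      rw [if_pos rfl, termD, if_pos hA]
      have e1 : quad d 0 = 0 := by simp [quad]
      have e2 : lin d (Bw 0 k) 0 = 0 := by simp [lin]
      rw [e1, e2]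
      simp only [mul_zero, sub_zero, zpow_zero, one_mul]
      apply Finset.prod_eq_one
      intro j _
      simp only [tp, Bw, cw, ite_self, Pi.zero_apply, gaussHalf]
      have e3 : (0 + 0 + ee k j + (0 + ee k j)) = 2 * ee k j := by ring
      have e4 : 0 ≤ ee k j := by unfold ee; split_ifs <;> omega
      rw [e3, if_pos (by omega)]
      exact gauss_zero hq (by omega)
    · rw [if_neg h]
      by_contra hne
      exact h (key 0 hne).1
  · intro m hm
    by_contra hne
    exact hm (key m hne).2

lemma main_claim {t : K} (ht : t ≠ 0) (hq : ∀ n : ℕ, 1 - t ^ (4 * (n + 1)) ≠ 0) {d l : ℕ}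
    (hl : l ≤ d + 1) (L : ℕ) : ∀ k, k ≤ d + 1 → (L + k + l) % 2 = 0 →
    t ^ ((L : ℤ) ^ 2 + l - k - (if k = 0 then 2 * (L : ℤ) else 0)) *
      DD t d (QQ k l) (ee l) (Bw L k) = BB t (d + 3) (d + 2 - l) L (d + 2 - k) := by
  induction L using Nat.strong_induction_on with
  | _ L ih =>
  have hR : (1 : ℤ) ≤ d + 3 := by omega
  rcases L with _ | n
  · intro k hk hp
    rw [Nat.cast_zero, ferm_init hq hk hl (by omega), BB_init hq (by omega) (by omega) (by omega)
      (by omega)]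
    by_cases h : k = l
    · subst h; simp
    · rw [if_neg h, if_neg (show ¬ ((d:ℤ)+2-k = d+2-l) by omega), mul_zero]
  intro k hk hp
  have hL1 : (1 : ℤ) ≤ ((n + 1 : ℕ) : ℤ) := by omega
  have c1 : ((n + 1 : ℕ) : ℤ) - 1 = n := by push_cast; ring
  have c2 : ((n + 1 : ℕ) : ℤ) - 2 = (n : ℤ) - 1 := by push_cast; ring
  -- the term with `L - 2`
  rcases Nat.lt_or_ge k 2 with hk2 | hk2
  · have hk01 : k = 0 ∨ k = 1 := by omega
    rcases hk01 with rfl | rfl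
    · have i1 := ih n (by omega) 1 (by omega) (by omega)
      rw [if_neg (by omega)] at i1
      rw [if_pos rfl, ferm_zero, c1]
      have hB := BB_edge ht hq hR hL1 ((d : ℤ) + 2 - l)
      rw [c1] at hB
      rw [show (d : ℤ) + 2 - ((0 : ℕ) : ℤ) = d + 3 - 1 by push_cast; ring, hB,
        show (d : ℤ) + 3 - 2 = d + 2 - ((1 : ℕ) : ℤ) by push_cast; ring, ← i1]
      congr 2; push_cast; ring
    · have i0 := ih n (by omega) 0 (by omega) (by omega)
      rw [if_pos rfl, show (d : ℤ) + 2 - ((0 : ℕ) : ℤ) = d + 2 by push_cast; ring] at i0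
      rw [if_neg (by omega)]
      obtain ⟨X, hX1, hX2⟩ : ∃ X : K, DD t d (QQ 1 l) (ee l) (Bw ((n + 1 : ℕ) : ℤ) 1) =
          t ^ (-2 * ((n + 1 : ℕ) : ℤ)) * X + DD t d (QQ 0 l) (ee l) (Bw (n : ℤ) 0) ∧
          t ^ ((n : ℤ) ^ 2 + l - 2) * X = BB t (d + 3) (d + 2 - l) n d := by
        rcases Nat.eq_zero_or_pos d with h0 | h0
        · refine ⟨0, ?_, ?_⟩
          · rw [mul_zero, zero_add]
            apply DD_congr; intro x _ _; omega
          · rw [h0, mul_zero, Nat.cast_zero, BB_zero]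
        · refine ⟨DD t d (QQ 2 l) (ee l) (Bw (n : ℤ) 2), ?_, ?_⟩
          · rw [ferm_rec_one ht hq hL1 h0, c1]
          · have i2 := ih n (by omega) 2 (by omega) (by omega)
            rw [if_neg (by omega)] at i2
            rw [show (d : ℤ) = d + 2 - ((2 : ℕ) : ℤ) by push_cast; ring] 
            simp only [sub_zero] at i2
            convert i2 using 2 <;> push_cast <;> ring
      have hB := BB_rec ht hq hR hL1 ((d : ℤ) + 2 - l) (d + 1)
      rw [c1, c2, show (d : ℤ) + 1 - 1 = d by ring, show (d : ℤ) + 1 + 1 = d + 2 by ring] at hB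
      have hB2 : BB t (d + 3) ((d : ℤ) + 2 - l) ((n + 1 : ℕ) : ℤ) (d + 1) =
          BB t (d + 3) ((d : ℤ) + 2 - l) n d +
            t ^ (4 * (n : ℤ)) * BB t (d + 3) ((d : ℤ) + 2 - l) n (d + 2) := by
        rw [hB]
        rcases Nat.eq_zero_or_pos n with h0 | h0
        · subst h0; simp
        · have hE := BB_edge ht hq hR (show (1 : ℤ) ≤ n by omega) ((d : ℤ) + 2 - l)
          rw [show (d : ℤ) + 3 - 1 = d + 2 by ring, show (d : ℤ) + 3 - 2 = d + 1 by ring] at hE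
          rw [hE]; ring
      rw [show (d : ℤ) + 2 - ((1 : ℕ) : ℤ) = d + 1 by push_cast; ring, hB2, ← hX2,
        ← i0, hX1, mul_add,
        ← mul_assoc, ← mul_assoc, ← zpow_add₀ ht, ← zpow_add₀ ht]
      congr 3 <;> push_cast <;> ring
  · -- `k ≥ 2`
    have im := ih n (by omega) (k - 1) (by omega) (by omega)
    rw [if_neg (by omega)] at im
    rw [if_neg (by omega)]
    have hZ : t ^ (((n + 1 : ℕ) : ℤ) ^ 2 + l - k - 0) *
        ((1 - t ^ (4 * (1 - ((n + 1 : ℕ) : ℤ)))) * DD t d (QQ k l) (ee l) (Bw ((n : ℤ) - 1) k)) =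
        (t ^ (4 * (n : ℤ)) - 1) * BB t (d + 3) (d + 2 - l) ((n : ℤ) - 1) (d + 2 - k) := by
      rcases n with _ | p
      · simp
      · have i2 := ih p (by omega) k hk (by omega)
        rw [if_neg (by omega)] at i2
        rw [show ((p + 1 : ℕ) : ℤ) - 1 = p by push_cast; ring, ← i2]
        have e1 : t ^ (((p + 1 + 1 : ℕ) : ℤ) ^ 2 + l - k - 0) =
            t ^ (4 * ((p + 1 : ℕ) : ℤ)) * t ^ ((p : ℤ) ^ 2 + l - k - 0) := by
          rw [← zpow_add₀ ht]; congr 1; push_cast; ring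
        have e2 : t ^ (4 * ((p + 1 : ℕ) : ℤ)) * t ^ (4 * (1 - ((p + 1 + 1 : ℕ) : ℤ))) = 1 := by
          rw [← zpow_add₀ ht, ← zpow_zero t]; congr 1; push_cast; ring
        rw [e1]
        linear_combination (-(t ^ ((p : ℤ) ^ 2 + l - k - 0) * DD t d (QQ k l) (ee l) (Bw (p : ℤ) k))) * e2
    obtain ⟨X, hX1, hX2⟩ : ∃ X : K, DD t d (QQ k l) (ee l) (Bw ((n + 1 : ℕ) : ℤ) k) =
        t ^ (-2 * ((n + 1 : ℕ) : ℤ)) * X +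
        t ^ (2 * (1 - ((n + 1 : ℕ) : ℤ))) * DD t d (QQ (k - 1) l) (ee l) (Bw (n : ℤ) (k - 1)) +
        (1 - t ^ (4 * (1 - ((n + 1 : ℕ) : ℤ)))) * DD t d (QQ k l) (ee l) (Bw ((n : ℤ) - 1) k) ∧
        t ^ ((n : ℤ) ^ 2 + l - k - 1) * X = BB t (d + 3) (d + 2 - l) n (d + 2 - k - 1) := by
      rcases Nat.lt_or_ge d k with h0 | h0
      · have hkd : k = d + 1 := by omega
        refine ⟨0, ?_, ?_⟩
        · rw [ferm_rec_end ht hq hL1 hk2 hkd, c1, c2]; ring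
        · rw [show (d : ℤ) + 2 - k - 1 = 0 by omega, mul_zero, BB_zero]
      · refine ⟨DD t d (QQ (k + 1) l) (ee l) (Bw (n : ℤ) (k + 1)), ?_, ?_⟩
        · rw [ferm_rec ht hq hL1 hk2 h0, c1, c2]
        · have i2 := ih n (by omega) (k + 1) (by omega) (by omega)
          rw [if_neg (by omega)] at i2
          rw [show (d : ℤ) + 2 - k - 1 = d + 2 - ((k + 1 : ℕ) : ℤ) by push_cast; ring, ← i2]
          congr 2; push_cast; ring
    have hB := BB_rec ht hq hR hL1 ((d : ℤ) + 2 - l) (d + 2 - k)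
    rw [c1, c2] at hB
    rw [hB, hX1, mul_add, hZ, mul_add, ← hX2,
      show (d : ℤ) + 2 - k + 1 = d + 2 - ((k - 1 : ℕ) : ℤ) by omega, ← im,
      ← mul_assoc, ← mul_assoc, ← zpow_add₀ ht, ← zpow_add₀ ht]
    congr 4
    · push_cast; ring
    · rw [Nat.cast_sub (by omega)]; push_cast; ring

lemma gauss_tri {t : K} (hq : ∀ n : ℕ, 1 - t ^ (4 * (n + 1)) ≠ 0) (N : ℤ) (k : ℕ) (s : ℤ) :
    gauss t N k * gauss t (N - k) (k + s) = gauss t N (2 * k + s) * gauss t (2 * k + s) (k + s) := by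
  by_cases h1 : (k : ℤ) + s < 0
  · rw [gauss_neg t h1, gauss_neg t h1]; simp
  by_cases h2 : N < 2 * k + s
  · rw [gauss_gt t h2, gauss_gt t (show N - k < k + s by omega)]; simp
  obtain ⟨p, hp⟩ : ∃ p : ℕ, s = (p : ℤ) - k := ⟨((k : ℤ) + s).toNat, by omega⟩
  obtain ⟨c, hc⟩ : ∃ c : ℕ, N = (k : ℤ) + p + c := ⟨(N - (k + p)).toNat, by omega⟩
  subst hp; subst hc
  have g1 := gauss_nat t k (p + c)
  have g2 := gauss_nat t p c
  have g3 := gauss_nat t (k + p) c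
  have g4 := gauss_nat t p k
  push_cast at g1 g3
  rw [show (k : ℤ) + p + c - k = p + c by ring, show (k : ℤ) + (p - k) = p by ring,
    show 2 * (k : ℤ) + (p - k) = k + p by ring, g2, g3, add_comm (k : ℤ) p, g4,
    show (p : ℤ) + k + c = k + (p + c) by ring, g1, add_comm p k, add_assoc]
  have := qp_ne hq k
  have := qp_ne hq p
  have := qp_ne hq c
  have := qp_ne hq (k + p)
  have := qp_ne hq (p + c)
  field_simp

lemma trinom_eq {t : K} (ht : t ≠ 0) (hq : ∀ n : ℕ, 1 - t ^ (4 * (n + 1)) ≠ 0) (L : ℕ) (s : ℤ) :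
    t ^ (s ^ 2) * trinom t L s =
      ∑ i ∈ Finset.range (L + 1), t ^ ((i : ℤ) ^ 2) * gauss t L i * bet t i s := by
  let F : ℕ → K := fun k => t ^ ((2 * (k : ℤ) + s) ^ 2) *
    (gauss t L (2 * k + s) * gauss t (2 * k + s) (k + s))
  have hF : ∀ k : ℕ, (2 * (k : ℤ) + s < 0 ∨ (L : ℤ) < 2 * k + s ∨ L < k) → F k = 0 := by
    intro k hk
    simp only [F]
    by_cases h1 : (L : ℤ) < 2 * k + s
    · rw [gauss_gt t h1]; simp
    · rw [gauss_neg t (show (k : ℤ) + s < 0 by omega)]; simp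
  have e1 : t ^ (s ^ 2) * trinom t L s = ∑ k ∈ Finset.range (L + 1), F k := by
    unfold trinom
    rw [mul_finsum, ← finsum_eq_sum_of_support_subset]
    · apply finsum_congr
      intro k
      simp only [F]
      rw [← gauss_tri hq]
      have : t ^ ((2 * (k : ℤ) + s) ^ 2) = t ^ (s ^ 2) * t ^ (4 * ((k : ℤ) * (k + s))) := by
        rw [← zpow_add₀ ht]; congr 1; ring
      rw [this]; ring
    · intro k hk
      by_contra h
      apply hk
      apply hF
      simp at h
      omega
  have e2 : ∀ i ∈ Finset.range (L + 1), t ^ ((i : ℤ) ^ 2) * gauss t L i * bet t i s =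
      ∑ k ∈ Finset.range (L + 1), if (i : ℤ) = 2 * k + s then F k else 0 := by
    intro i hi
    rw [Finset.mem_range] at hi
    by_cases hex : ∃ k ∈ Finset.range (L + 1), (i : ℤ) = 2 * k + s
    · obtain ⟨k, hk, hik⟩ := hex
      rw [Finset.sum_eq_single_of_mem k hk]
      · rw [if_pos hik]
        simp only [F]
        rw [← hik, show s = 2 * ((k : ℤ) + s) - i by omega, bet_even,
          show (k : ℤ) + (2 * (k + s) - i) = k + s by omega]
        ring
      · intro k' _ hne
        rw [if_neg]
        omega
    · rw [Finset.sum_eq_zero]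
      · by_cases hp : ((i : ℤ) + s) % 2 = 0
        · obtain ⟨m, hm⟩ : ∃ m, s = 2 * m - (i : ℤ) := ⟨((i : ℤ) + s) / 2, by omega⟩
          rw [hm, bet_even]
          by_cases h1 : (i : ℤ) < m
          · rw [gauss_gt t h1, mul_zero]
          · by_cases h2 : m < 0
            · rw [gauss_neg t h2, mul_zero]
            · exfalso
              apply hex
              exact ⟨((i : ℤ) - m).toNat, by simp; omega, by omega⟩
        · rw [bet_odd t hp, mul_zero]
      · intro k hk
        rw [if_neg]
        exact fun h => hex ⟨k, hk, h⟩
  rw [e1, Finset.sum_congr rfl e2, Finset.sum_comm]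
  apply Finset.sum_congr rfl
  intro k _
  by_cases h : 0 ≤ 2 * (k : ℤ) + s ∧ 2 * (k : ℤ) + s ≤ L
  · rw [Finset.sum_eq_single_of_mem (2 * (k : ℤ) + s).toNat (by simp; omega)]
    · rw [if_pos (by omega)]
    · intro i _ hne
      rw [if_neg (by omega)]
  · rw [hF k (by omega)]; simp

lemma rhs_eq {t : K} (ht : t ≠ 0) (hq : ∀ n : ℕ, 1 - t ^ (4 * (n + 1)) ≠ 0) (L : ℕ) (r a b : ℤ)
    (hr : 2 ≤ r) :
    ∑ᶠ j : ℤ, (t ^ (4 * (j * (r * (r - 1) * j + r * b - (r - 1) * a))) *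
          trinom t L (2 * (r - 1) * j + b - a)
        - t ^ (4 * (((r - 1) * j + b) * (r * j + a))) * trinom t L (2 * (r - 1) * j + b + a)) =
      ∑ i ∈ Finset.range (L + 1), t ^ ((i : ℤ) ^ 2 - (a - b) ^ 2) * gauss t L i * BB t (r - 1) b i a := by
  have hS : ∀ c (i : ℤ), (Function.support fun j : ℤ => t ^ (4 * ((r - 1) * j ^ 2 + b * j)) *
      bet t i (c - b - 2 * (r - 1) * j)).Finite := fun c i => SS_fin t (r - 1) b i c (by omega) _
  have e1 : ∀ i : ℤ, BB t (r - 1) b i a = ∑ᶠ j : ℤ, (t ^ (4 * ((r - 1) * j ^ 2 + b * j)) *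
      bet t i (a - b - 2 * (r - 1) * j) - t ^ (4 * ((r - 1) * j ^ 2 + b * j)) *
      bet t i (-a - b - 2 * (r - 1) * j)) := by
    intro i
    rw [finsum_sub_distrib (hS a i) (hS (-a) i)]; rfl
  simp only [e1, mul_finsum]
  rw [← finsum_sum_comm]
  · apply finsum_congr
    intro j
    have t1 := trinom_eq ht hq L (2 * (r - 1) * j + b - a)
    have t2 := trinom_eq ht hq L (2 * (r - 1) * j + b + a)
    have x1 : t ^ (4 * (j * (r * (r - 1) * j + r * b - (r - 1) * a))) =
        t ^ (4 * ((r - 1) * j ^ 2 + b * j) - (a - b) ^ 2) * t ^ ((2 * (r - 1) * j + b - a) ^ 2) := by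
      rw [← zpow_add₀ ht]; congr 1; ring
    have x2 : t ^ (4 * (((r - 1) * j + b) * (r * j + a))) =
        t ^ (4 * ((r - 1) * j ^ 2 + b * j) - (a - b) ^ 2) * t ^ ((2 * (r - 1) * j + b + a) ^ 2) := by
      rw [← zpow_add₀ ht]; congr 1; ring
    rw [x1, x2, mul_assoc (t ^ (4 * ((r - 1) * j ^ 2 + b * j) - (a - b) ^ 2)), t1,
      mul_assoc (t ^ (4 * ((r - 1) * j ^ 2 + b * j) - (a - b) ^ 2)), t2, Finset.mul_sum, Finset.mul_sum,
      ← Finset.sum_sub_distrib]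
    apply Finset.sum_congr rfl
    intro i _
    rw [bet_symm t i (2 * (r - 1) * j + b - a), bet_symm t i (2 * (r - 1) * j + b + a),
      show -(2 * (r - 1) * j + b - a) = a - b - 2 * (r - 1) * j by ring,
      show -(2 * (r - 1) * j + b + a) = -a - b - 2 * (r - 1) * j by ring,
      zpow_sub₀ ht, zpow_sub₀ ht]
    ring
  · intro i _
    apply ((hS a i).union (hS (-a) i)).subset
    intro j hj
    have := (mul_ne_zero_iff.1 hj).2
    by_contra hh
    rw [Set.mem_union, not_or, Function.notMem_support, Function.notMem_support] at hh
    apply this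
    rw [hh.1, hh.2, sub_zero]

/-- extension by zero -/
def exN {n : ℕ} (m : Fin n → ℕ) (x : ℕ) : ℤ := if h : x < n then (m ⟨x, h⟩ : ℤ) else 0

/-- extension by zero, dropping the first entry -/
def exM {n : ℕ} (m : Fin n → ℕ) (x : ℕ) : ℤ := if 1 ≤ x then exN m x else 0

lemma exN_fin {n : ℕ} (m : Fin n → ℕ) (i : Fin n) : (m i : ℤ) = exN m i := by
  simp [exN]

lemma exN_ge {n : ℕ} (m : Fin n → ℕ) {x : ℕ} (h : n ≤ x) : exN m x = 0 := by
  unfold exN; rw [dif_neg (by omega)]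

lemma mAt_eq {n : ℕ} (m : Fin n → ℕ) (k : ℕ) : mAt n m ((k : ℤ) + 1) = exN m k := by
  unfold mAt uv
  simp only [exN_fin m]
  rw [Fin.sum_univ_eq_sum_range (fun x => (if ((x : ℕ) : ℤ) + 1 = (k : ℤ) + 1 then (1 : ℤ) else 0) * exN m x)]
  by_cases h : k < n
  · rw [Finset.sum_eq_single_of_mem k (by simpa using h)]
    · simp
    · intro x _ hx
      rw [if_neg (by omega), zero_mul]
  · rw [exN_ge m (by omega)]
    apply Finset.sum_eq_zero
    intro x hx
    rw [Finset.mem_range] at hx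
    rw [if_neg (by omega), zero_mul]

lemma inc_sum {n : ℕ} (m : Fin n → ℕ) (i : Fin n) : ∑ k, inc n i k * (m k : ℤ) =
    (if 1 ≤ (i : ℕ) then exN m ((i : ℕ) - 1) else 0) + exN m ((i : ℕ) + 1) := by
  unfold inc
  simp only [exN_fin m]
  rw [Fin.sum_univ_eq_sum_range (fun x => (if (i : ℕ) + 1 = x ∨ x + 1 = (i : ℕ) then (1 : ℤ) else 0) * exN m x)]
  have h1 : ∀ x ∈ Finset.range n, (if (i : ℕ) + 1 = x ∨ x + 1 = (i : ℕ) then (1 : ℤ) else 0) * exN m x =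
      (if x = (i : ℕ) - 1 then (if 1 ≤ (i : ℕ) then exN m x else 0) else 0) +
      (if x = (i : ℕ) + 1 then exN m x else 0) := by
    intro x _
    split_ifs <;> first | (exfalso; omega) | simp
  rw [Finset.sum_congr rfl h1, Finset.sum_add_distrib, Finset.sum_ite_eq', Finset.sum_ite_eq',
    if_pos (by have := i.2; simp; omega)]
  congr 1
  split_ifs with h
  · rfl
  · rw [exN_ge]; simpa using h

lemma quad_aux (N : ℕ → ℤ) (n : ℕ) :
    ∑ x ∈ Finset.range (n + 1), N x * (2 * N x - ((if 1 ≤ x then N (x - 1) else 0) + N (x + 1))) =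
    (N 0) ^ 2 + ∑ j ∈ Finset.range (n + 1), (N (j + 1) - N j) ^ 2 - (N (n + 1)) ^ 2 +
      N n * N (n + 1) := by
  induction n with
  | zero => simp; ring
  | succ n ih =>
    rw [Finset.sum_range_succ, ih, Finset.sum_range_succ _ (n + 1), if_pos (by omega),
      Nat.add_sub_cancel]
    ring

lemma quadC_eq {n d : ℕ} (hn : n = d + 1) (m : Fin n → ℕ) :
    quadC n m = 2 * (exN m 0) ^ 2 + quad d (exM m) - 2 * (exN m 0 * exM m 1) := by
  have h1 : ∀ i : Fin n, ∑ k, (m i : ℤ) * cartan n i k * (m k : ℤ) =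
      exN m i * (2 * exN m i - ((if 1 ≤ (i : ℕ) then exN m ((i : ℕ) - 1) else 0) + exN m ((i : ℕ) + 1))) := by
    intro i
    rw [← inc_sum]
    unfold cartan
    simp only [mul_assoc, sub_mul]
    rw [← Finset.mul_sum, Finset.sum_sub_distrib, ← exN_fin]
    congr 2
    simp
  unfold quadC
  rw [Finset.sum_congr rfl fun i _ => h1 i,
    Fin.sum_univ_eq_sum_range (fun x => exN m x * (2 * exN m x - ((if 1 ≤ x then exN m (x - 1) else 0) + exN m (x + 1)))),
    show Finset.range n = Finset.range (d + 1) by rw [hn], quad_aux, exN_ge m (show n ≤ d + 1 by omega)]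
  unfold quad
  rw [Finset.sum_range_succ', Finset.sum_range_succ']
  simp only [exM, Nat.le_add_left, if_true, le_refl, zero_add]
  rw [if_neg (by omega)]
  ring

lemma lin_eq {d k : ℕ} (hk : k ≤ d + 1) (i : ℤ) (M : ℕ → ℤ) :
    lin d (Bw i k) M = i * M 1 + M k := by
  unfold lin Bw
  simp only [add_mul]
  rw [Finset.sum_add_distrib, Finset.sum_eq_single_of_mem 1 (by simp),
    Finset.sum_eq_single_of_mem k (by simp; omega)]
  · simp [cw, ee]
  · intro x _ hx; simp [ee, hx]
  · intro x _ hx; simp [cw, hx]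

/-- target summand -/
def hh (t : K) (L d k l : ℕ) (p : ℕ × (ℕ → ℤ)) : K :=
  if (p.1 + k + l) % 2 = 0 then
    t ^ (2 * (p.1 : ℤ) ^ 2 - (if k = 0 then 2 * (p.1 : ℤ) else 0)) * gauss t L p.1 *
      termD t d (QQ k l) (ee l) (Bw p.1 k) p.2
  else 0

/-- reindexing -/
def phi {n : ℕ} (m : Fin n → ℕ) : ℕ × (ℕ → ℤ) := ((exN m 0).toNat, exM m)

lemma exN_nonneg {n : ℕ} (m : Fin n → ℕ) (x : ℕ) : 0 ≤ exN m x := by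
  unfold exN; split_ifs <;> omega

lemma phi_inj {n : ℕ} : Function.Injective (phi : (Fin n → ℕ) → ℕ × (ℕ → ℤ)) := by
  intro m m' h
  simp only [phi, Prod.mk.injEq] at h
  have key : ∀ x, exN m x = exN m' x := by
    intro x
    rcases Nat.eq_zero_or_pos x with rfl | hx
    · have := exN_nonneg m 0
      have := exN_nonneg m' 0
      omega
    · have := congrFun h.2 x
      simpa [exM, show 1 ≤ x from hx] using this
  funext i
  have := key i
  rw [← exN_fin, ← exN_fin] at this
  exact_mod_cast this

lemma pointwise {t : K} (ht : t ≠ 0) (L d k l a b : ℕ) (hk : k + a = d + 2) (hl : l + b = d + 2)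
    (ha : 1 ≤ a) (hb : 1 ≤ b) (m : Fin (d + 4 - 3) → ℕ) :
    (if parity (d + 4) a b m then
      t ^ (quadC (d + 4 - 3) m - 2 * mAt (d + 4 - 3) m (((d + 4 : ℕ) : ℤ) - a - 1))
        * gauss t (L : ℤ) (mAt (d + 4 - 3) m 1)
        * ∏ i : Fin (d + 4 - 3), (if 1 ≤ (i : ℕ) then gaussHalf t (topNoL (d + 4) a b m i) (m i) else 1)
      else 0) = hh t L d k l (phi m) := by
  have hn : d + 4 - 3 = d + 1 := rfl
  have e0 : (((exN m 0).toNat : ℕ) : ℤ) = exN m 0 := Int.toNat_of_nonneg (exN_nonneg m 0)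
  have hpar : parity (d + 4) a b m ↔
      (((exN m 0).toNat + k + l) % 2 = 0 ∧ Adm d (QQ k l) (exM m)) := by
    have hQ : ∀ i : Fin (d + 4 - 3), (m i % 2 = Qab (d + 4) a b i % 2 ↔
        (exN m i - QQ k l i) % 2 = 0) := by
      intro i
      have hi := i.2
      rw [← exN_fin]
      unfold Qab QQ
      omega
    unfold parity
    constructor
    · intro h
      constructor
      · have := (hQ ⟨0, by omega⟩).1 (h _)
        simp only [QQ] at this
        omega
      · intro j
        constructor
        · intro hj
          have := (hQ ⟨j, by omega⟩).1 (h _)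
          simpa [exM, hj.1] using this
        · intro hj
          unfold exM
          split_ifs with h1
          · exact exN_ge m (by omega)
          · rfl
    · rintro ⟨h0, hA⟩ i
      rw [hQ]
      have hi := i.2
      rcases Nat.eq_zero_or_pos (i : ℕ) with hz | hz
      · rw [hz]; simp only [QQ]; omega
      · have := (hA i).1 ⟨hz, by omega⟩
        simpa [exM, show 1 ≤ (i : ℕ) from hz] using this
  unfold hh phi termD
  simp only
  by_cases hp : ((exN m 0).toNat + k + l) % 2 = 0
  · by_cases hA : Adm d (QQ k l) (exM m)
    · rw [if_pos (hpar.2 ⟨hp, hA⟩), if_pos hp, if_pos hA, e0]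
      have x1 : mAt (d + 4 - 3) m (((d + 4 : ℕ) : ℤ) - a - 1) = exN m k := by
        rw [← mAt_eq]; congr 1; push_cast; omega
      have x2 : mAt (d + 4 - 3) m 1 = exN m 0 := by
        rw [← mAt_eq]; simp
      rw [x1, x2, quadC_eq hn, lin_eq (by omega)]
      have x3 : ∏ i : Fin (d + 4 - 3), (if 1 ≤ (i : ℕ) then gaussHalf t (topNoL (d + 4) a b m i) (m i) else 1)
          = ∏ j ∈ Finset.Icc 1 d, gaussHalf t (tp (ee l) (Bw (exN m 0) k) (exM m) j) (exM m j) := by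
        have y1 : ∀ i : Fin (d + 4 - 3), (if 1 ≤ (i : ℕ) then gaussHalf t (topNoL (d + 4) a b m i) (m i) else 1)
            = if 1 ≤ (i : ℕ) then gaussHalf t (tp (ee l) (Bw (exN m 0) k) (exM m) i) (exM m i) else 1 := by
          intro i
          split_ifs with hi
          · have z1 : exM m i = m i := by rw [exM, if_pos hi, ← exN_fin]
            rw [z1]
            congr 1
            unfold topNoL
            rw [inc_sum, if_pos hi]
            simp only [tp, Bw, cw, ee, uv, exM, Nat.le_add_left, if_true]
            have z2 : (((i : ℕ) : ℤ) + 1 = ((d + 4 : ℕ) : ℤ) - a - 1) = ((i : ℕ) = k) := by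
              apply propext; omega
            have z3 : (((i : ℕ) : ℤ) + 1 = ((d + 4 : ℕ) : ℤ) - b - 1) = ((i : ℕ) = l) := by
              apply propext; omega
            simp only [z2, z3]
            by_cases h1 : (i : ℕ) = 1
            · rw [if_neg (show ¬ 1 ≤ (i : ℕ) - 1 by omega), if_pos h1, h1]
              simp only [Nat.sub_self]; ring
            · rw [if_pos (show 1 ≤ (i : ℕ) - 1 by omega), if_neg h1]; ring
          · rfl
        rw [Finset.prod_congr rfl fun i _ => y1 i,
          Fin.prod_univ_eq_prod_range (fun x => if 1 ≤ x then gaussHalf t (tp (ee l) (Bw (exN m 0) k) (exM m) x) (exM m x) else 1),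
          ← Finset.prod_filter]
        apply Finset.prod_congr _ fun _ _ => rfl
        ext x
        simp only [Finset.mem_filter, Finset.mem_range, Finset.mem_Icc]
        omega
      rw [x3]
      have x4 : t ^ (2 * exN m 0 ^ 2 + quad d (exM m) - 2 * (exN m 0 * exM m 1) - 2 * exN m k) =
          t ^ (2 * exN m 0 ^ 2 - if k = 0 then 2 * exN m 0 else 0) *
          t ^ (quad d (exM m) - 2 * (exN m 0 * exM m 1 + exM m k)) := by
        rw [← zpow_add₀ ht]
        congr 1
        rcases Nat.eq_zero_or_pos k with hk0 | hk0
        · rw [if_pos hk0, hk0]; simp only [exM]; rw [if_neg (show ¬ 1 ≤ 0 by omega)]; ring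
        · rw [if_neg (by omega), show exM m k = exN m k by rw [exM, if_pos (show 1 ≤ k from hk0)]]; ring
      rw [x4]; ring
    · rw [if_neg (fun h => hA (hpar.1 h).2), if_pos hp, if_neg hA, mul_zero]
  · rw [if_neg (fun h => hp (hpar.1 h).1), if_neg hp]

lemma hh_support (t : K) (L d k l : ℕ) {p : ℕ × (ℕ → ℤ)} (h : hh t L d k l p ≠ 0) :
    p.1 ≤ L ∧ Adm d (QQ k l) p.2 ∧ (∀ j, 0 ≤ p.2 j) ∧
      termD t d (QQ k l) (ee l) (Bw p.1 k) p.2 ≠ 0 := by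
  unfold hh at h
  by_cases h1 : (p.1 + k + l) % 2 = 0
  · rw [if_pos h1] at h
    have h2 := mul_ne_zero_iff.1 h
    have h3 := mul_ne_zero_iff.1 h2.1
    have hL : p.1 ≤ L := by
      by_contra hc
      exact h3.2 (gauss_gt t (by omega))
    have ht := h2.2
    have hA : Adm d (QQ k l) p.2 := by
      by_contra hc
      apply ht
      unfold termD
      rw [if_neg hc]
    refine ⟨hL, hA, ?_, ht⟩
    intro j
    by_cases hj : 1 ≤ j ∧ j ≤ d
    · unfold termD at ht
      rw [if_pos hA] at ht
      have := Finset.prod_ne_zero_iff.1 (mul_ne_zero_iff.1 ht).2 j (by simpa using hj)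
      by_contra hc
      exact this (gaussHalf_neg t _ (by omega))
    · rw [(hA j).2 hj]
  · rw [if_neg h1] at h
    exact absurd rfl h

lemma lhs_eq {t : K} (ht : t ≠ 0) (hq : ∀ n : ℕ, 1 - t ^ (4 * (n + 1)) ≠ 0)
    (L d k l a b : ℕ) (hk : k + a = d + 2) (hl : l + b = d + 2)
    (ha : 1 ≤ a) (hb : 1 ≤ b) :
    t ^ (-(((a : ℤ) - b) * ((a : ℤ) - b - 1))) * ∑ᶠ m : Fin (d + 4 - 3) → ℕ,
    (if parity (d + 4) a b m then
      t ^ (quadC (d + 4 - 3) m - 2 * mAt (d + 4 - 3) m (((d + 4 : ℕ) : ℤ) - a - 1))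
        * gauss t (L : ℤ) (mAt (d + 4 - 3) m 1)
        * ∏ i : Fin (d + 4 - 3), (if 1 ≤ (i : ℕ) then gaussHalf t (topNoL (d + 4) a b m i) (m i) else 1)
      else 0) =
    ∑ i ∈ Finset.range (L + 1), t ^ ((i : ℤ) ^ 2 - ((a : ℤ) - b) ^ 2) * gauss t L i *
      BB t (((d + 4 : ℕ) : ℤ) - 1) b i a := by
  have hn : d + 4 - 3 = d + 1 := rfl
  rw [finsum_congr fun m => pointwise ht L d k l a b hk hl ha hb m,
    ← finsum_mem_range (f := hh t L d k l) phi_inj]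
  have s1 : ∑ᶠ p ∈ Set.range (phi : (Fin (d + 4 - 3) → ℕ) → ℕ × (ℕ → ℤ)), hh t L d k l p =
      ∑ᶠ p, hh t L d k l p := by
    rw [finsum_mem_def]
    rw [Set.indicator_eq_self.2]
    intro p hp
    obtain ⟨_, hA, hpos, _⟩ := hh_support t L d k l hp
    refine ⟨fun i => if (i : ℕ) = 0 then p.1 else (p.2 i).toNat, ?_⟩
    apply Prod.ext
    · simp [phi, exN]
    · funext x
      simp only [phi, exM, exN]
      by_cases hx : 1 ≤ x ∧ x ≤ d
      · rw [if_pos hx.1, dif_pos (by omega), if_neg (by omega), Int.toNat_of_nonneg (hpos x)]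
      · rw [(hA x).2 hx]
        by_cases h1 : 1 ≤ x
        · rw [if_pos h1, dif_neg (by omega)]
        · rw [if_neg h1]
  rw [s1, finsum_curry]
  swap
  · have hf : (⋃ i ∈ Finset.range (L + 1), Set.image (Prod.mk i)
        (Function.support fun M => termD t d (QQ k l) (ee l) (Bw (i : ℤ) k) M)).Finite :=
      Set.Finite.biUnion (Finset.finite_toSet _) fun i _ => (termD_fin t d _ _ _).image _
    apply hf.subset
    intro p hp
    obtain ⟨hL, _, _, hT⟩ := hh_support t L d k l hp
    simp only [Set.mem_iUnion]
    exact ⟨p.1, by simp; omega, p.2, hT, rfl⟩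
  rw [finsum_eq_sum_of_support_subset (s := Finset.range (L + 1)), Finset.mul_sum]
  swap
  · intro i hi
    by_contra hc
    apply hi
    rw [← finsum_zero (α := ℕ → ℤ)]
    apply finsum_congr
    intro M
    by_contra h
    have := (hh_support t L d k l h).1
    simp at hc this
    omega
  apply Finset.sum_congr rfl
  intro i _
  by_cases hp : (i + k + l) % 2 = 0
  · have hm := main_claim ht hq (d := d) (l := l) (by omega) i k (by omega) hp
    rw [show ((d + 4 : ℕ) : ℤ) - 1 = d + 3 by push_cast; ring, show (b : ℤ) = d + 2 - l by omega,
      show (a : ℤ) = d + 2 - k by omega, ← hm]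
    simp only [hh, if_pos hp]
    rw [← mul_finsum, ← DD]
    have e1 : t ^ (-((((d : ℤ) + 2 - k) - (d + 2 - l)) * (((d : ℤ) + 2 - k) - (d + 2 - l) - 1))) *
        t ^ (2 * (i : ℤ) ^ 2 - if k = 0 then 2 * (i : ℤ) else 0) =
        t ^ ((i : ℤ) ^ 2 - (((d : ℤ) + 2 - k) - (d + 2 - l)) ^ 2) *
        t ^ ((i : ℤ) ^ 2 + l - k - if k = 0 then 2 * (i : ℤ) else 0) := by
      rw [← zpow_add₀ ht, ← zpow_add₀ ht]
      congr 1
      ring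
    linear_combination (gauss t L i * DD t d (QQ k l) (ee l) (Bw i k)) * e1
  · rw [BB_odd t (by omega), mul_zero]
    simp only [hh, if_neg hp]
    simp

lemma X_pow_ne (n : ℕ) : 1 - (RatFunc.X : RatFunc ℚ) ^ (4 * (n + 1)) ≠ 0 := by
  intro h
  have h1 : algebraMap (Polynomial ℚ) (RatFunc ℚ) (1 - Polynomial.X ^ (4 * (n + 1))) =
      algebraMap (Polynomial ℚ) (RatFunc ℚ) 0 := by
    rw [map_sub, map_one, map_pow, RatFunc.algebraMap_X, h, map_zero]
  have h2 := RatFunc.algebraMap_injective ℚ h1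
  have h3 := congrArg (Polynomial.eval 0) h2
  simp at h3

end helpers

/-- **The "railroad" polynomial identity** with `q`-trinomial coefficients, stated in
the variable `t = q^{1/4}` (all exponents multiplied by `4`). -/
theorem railroad_identity (r a b L : ℕ) (hr : 3 ≤ r) (ha : 1 ≤ a) (ha' : a ≤ r - 2)
    (hb : 1 ≤ b) (hb' : b ≤ r - 2) :
    (RatFunc.X : RatFunc ℚ) ^ (-(((a : ℤ) - b) * ((a : ℤ) - b - 1)))
        * ∑ᶠ m : Fin (r - 3) → ℕ,
          (if parity r a b m then
            (RatFunc.X : RatFunc ℚ) ^ (quadC (r - 3) m - 2 * mAt (r - 3) m ((r : ℤ) - a - 1))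
              * gauss RatFunc.X (L : ℤ) (mAt (r - 3) m 1)
              * ∏ i : Fin (r - 3), (if 1 ≤ (i : ℕ) then gaussHalf RatFunc.X (topNoL r a b m i) (m i) else 1)
          else 0)
      = ∑ᶠ j : ℤ,
          ((RatFunc.X : RatFunc ℚ) ^
                (4 * (j * ((r : ℤ) * ((r : ℤ) - 1) * j + (r : ℤ) * b - ((r : ℤ) - 1) * a)))
              * trinom RatFunc.X (L : ℤ) (2 * ((r : ℤ) - 1) * j + b - a)
            - (RatFunc.X : RatFunc ℚ) ^
                (4 * ((((r : ℤ) - 1) * j + b) * ((r : ℤ) * j + a)))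
              * trinom RatFunc.X (L : ℤ) (2 * ((r : ℤ) - 1) * j + b + a)) := by
  have ht : (RatFunc.X : RatFunc ℚ) ≠ 0 := RatFunc.X_ne_zero
  have hq := X_pow_ne
  rw [rhs_eq ht hq L r a b (by omega)]
  rcases Nat.lt_or_ge 3 r with h | h
  · obtain ⟨d, rfl⟩ : ∃ d, r = d + 4 := ⟨r - 4, by omega⟩
    exact lhs_eq ht hq L d (d + 2 - a) (d + 2 - b) a b (by omega) (by omega) ha hb
  · have hr3 : r = 3 := by omega
    subst hr3
    have ha1 : a = 1 := by omega
    have hb1 : b = 1 := by omega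
    subst ha1
    subst hb1
    rw [Finset.sum_eq_single_of_mem 0 (by simp)]
    · have hB := BB_init (t := (RatFunc.X : RatFunc ℚ)) hq (R := 2) (a := 1) (b := 1)
        (by norm_num) (by norm_num) (by norm_num) (by norm_num)
      rw [if_pos rfl] at hB
      have hg := gauss_zero hq (show (0 : ℤ) ≤ (L : ℤ) by omega)
      have huniq : ∀ f : (Fin (3 - 3) → ℕ) → RatFunc ℚ, ∑ᶠ m, f m = f (fun _ => 0) := by
        intro f
        apply finsum_eq_single
        intro x hx
        exact absurd (funext fun i => absurd i.2 (by omega)) hx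
      have hpar : parity 3 1 1 (fun _ => 0) := fun i => absurd i.2 (by omega)
      rw [huniq, if_pos hpar]
      have e1 : ∀ s, mAt (3 - 3) (fun _ => 0) s = 0 := by intro s; simp [mAt]
      have e2 : quadC (3 - 3) (fun _ => 0) = 0 := by simp [quadC]
      rw [e1, e1, e2]
      simp only [Nat.cast_zero, Nat.cast_one, Nat.cast_ofNat]
      rw [show (3 : ℤ) - 1 = 2 by norm_num, hB, hg]
      simp
    · intro i _ hi
      have hB := BB_edge ht hq (R := 2) (L := i) (by norm_num) (by omega) 1
      rw [show (2 : ℤ) - 1 = 1 by norm_num, show (2 : ℤ) - 2 = 0 by norm_num, BB_zero] at hB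
      rw [Nat.cast_one, show ((3 : ℕ) : ℤ) - 1 = 2 by norm_num, hB, mul_zero]
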